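/- arXiv:0711.4175 — 3 statements merged into one kernel-verified Lean document; each statement's English description precedes it below -/
import Mathlib

section
/- For every finite directed graph G = (V,E), the general entropy equals the general guessing number: E(G) = g(G), where E(G) = sup_{s≥2} E(G,s) and g(G) = sup_{s≥2} g(G,s). -/
open Finset

/-! ## Basic setup: directed graphs, guessing games, entropy (Riis, "Graph Entropy,
Network Coding and Guessing games"). -/

/-- The set `N⁻(j)` of in-neighbours of a vertex `j` in the directed graph given by
the edge relation `E` (an edge `(i,j)` is `E i j`). -/
def inNbr {V : Type*} [Fintype V] (E : V → V → Prop) [DecidableRel E] (j : V) : Finset V :=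
  Finset.univ.filter (fun i => E i j)

/-- `p` is a probability distribution on `V → A`. -/
def IsProbDist {V A : Type*} [Fintype V] [DecidableEq V] [Fintype A] (p : (V → A) → ℝ) : Prop :=
  (∀ x, 0 ≤ p x) ∧ ∑ x : V → A, p x = 1

/-- The marginal probability, under `p`, that the coordinates in `S` agree with `y`. -/
noncomputable def marginalPMF {V A : Type*} [Fintype V] [DecidableEq V] [Fintype A] [DecidableEq A]
    (p : (V → A) → ℝ) (S : Finset V) (y : ↥S → A) : ℝ :=
  ∑ x : V → A, if ∀ i : ↥S, x i.1 = y i then p x else 0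

/-- `Hent s p S` : the base-`s` Shannon entropy of the marginal of `p` on the
coordinates in `S` (using `Real.negMulLog`, so the convention `0·log(1/0) = 0` holds). -/
noncomputable def Hent {V A : Type*} [Fintype V] [DecidableEq V] [Fintype A] [DecidableEq A]
    (s : ℕ) (p : (V → A) → ℝ) (S : Finset V) : ℝ :=
  (∑ y : ↥S → A, Real.negMulLog (marginalPMF p S y)) / Real.log s

/-- `p` satisfies the information constraints of the graph: `H(j | N⁻(j)) = 0` for every
vertex `j`, where `H(X | Y) = H(X ∪ Y) − H(Y)`. -/
def InfoConstraints {V A : Type*} [Fintype V] [DecidableEq V] [Fintype A] [DecidableEq A]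
    (E : V → V → Prop) [DecidableRel E] (s : ℕ) (p : (V → A) → ℝ) : Prop :=
  ∀ j : V, Hent s p (insert j (inNbr E j)) - Hent s p (inNbr E j) = 0

/-- The (private) entropy `E(G,s)` of the graph over an alphabet of size `s`:
the sup of `H_p(V)` over probability distributions on `A^V` (`A = Fin s`)
satisfying the information constraints of the graph. -/
noncomputable def graphEntropy {V : Type*} [Fintype V] [DecidableEq V]
    (E : V → V → Prop) [DecidableRel E] (s : ℕ) : ℝ :=
  sSup {h : ℝ | ∃ p : (V → Fin s) → ℝ,
    IsProbDist p ∧ InfoConstraints E s p ∧ h = Hent s p Finset.univ}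

/-- The general entropy `E(G) = sup_{s ≥ 2} E(G,s)`. -/
noncomputable def genEntropy {V : Type*} [Fintype V] [DecidableEq V]
    (E : V → V → Prop) [DecidableRel E] : ℝ :=
  sSup {h : ℝ | ∃ s : ℕ, 2 ≤ s ∧ h = graphEntropy E s}

/-- A guessing strategy: each vertex `j` guesses a value `g j x` which may only depend on
the values `x i` for in-neighbours `i` of `j`. -/
def IsStrategy {V A : Type*} (E : V → V → Prop) (g : V → (V → A) → A) : Prop :=
  ∀ j x y, (∀ i, E i j → x i = y i) → g j x = g j y

/-- The set of assignments at which all players guess correctly. -/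
def correctSet {V A : Type*} [Fintype V] [DecidableEq V] [Fintype A] [DecidableEq A]
    (g : V → (V → A) → A) : Finset (V → A) :=
  Finset.univ.filter (fun x => ∀ j, g j x = x j)

/-- The maximal number of assignments at which all players guess correctly,
over all guessing strategies (over the alphabet `Fin s`). -/
noncomputable def maxCorrect {V : Type*} [Fintype V] [DecidableEq V]
    (E : V → V → Prop) [DecidableRel E] (s : ℕ) : ℕ :=
  sSup {m : ℕ | ∃ g : V → (V → Fin s) → Fin s, IsStrategy E g ∧ m = (correctSet g).card}

/-- The maximal probability (with `x` uniform on `A^V`) that all players guess correctly. -/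
noncomputable def maxProb {V : Type*} [Fintype V] [DecidableEq V]
    (E : V → V → Prop) [DecidableRel E] (s : ℕ) : ℝ :=
  (maxCorrect E s : ℝ) / (s : ℝ) ^ Fintype.card V

/-- The guessing number `g(G,s)`: the unique `α` with maximal success probability
`(1/s)^(n−α)`, i.e. `α = n + log_s (maximal probability)`. -/
noncomputable def guessingNumber {V : Type*} [Fintype V] [DecidableEq V]
    (E : V → V → Prop) [DecidableRel E] (s : ℕ) : ℝ :=
  (Fintype.card V : ℝ) + Real.logb s (maxProb E s)

/-- The general guessing number `g(G) = sup_{s ≥ 2} g(G,s)`. -/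
noncomputable def genGuessing {V : Type*} [Fintype V] [DecidableEq V]
    (E : V → V → Prop) [DecidableRel E] : ℝ :=
  sSup {h : ℝ | ∃ s : ℕ, 2 ≤ s ∧ h = guessingNumber E s}

/-! ## Entropy-like functions -/

/-- An S-entropy-like function: `f ∅ = 0`, monotone and submodular (the polymatroidal
axioms, equivalently Shannon's information inequalities). -/
def SEntLike {U : Type*} [DecidableEq U] (f : Finset U → ℝ) : Prop :=
  f ∅ = 0 ∧ (∀ X Y, X ⊆ Y → f X ≤ f Y) ∧ ∀ X Y, f (X ∩ Y) + f (X ∪ Y) ≤ f X + f Y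

/-- Mutual information `I_f(X;Y|Z)` of an entropy-like function. -/
def mutI {U : Type*} [DecidableEq U] (f : Finset U → ℝ) (X Y Z : Finset U) : ℝ :=
  f (X ∪ Z) + f (Y ∪ Z) - f (X ∪ Y ∪ Z) - f Z

/-- A Zhang–Yeung entropy-like function: S-entropy-like and satisfying the ZY
non-Shannon information inequality for all `A B C D`. -/
def ZYEntLike {U : Type*} [DecidableEq U] (f : Finset U → ℝ) : Prop :=
  SEntLike f ∧ ∀ A B C D : Finset U,
    2 * mutI f C D ∅ ≤ mutI f A B ∅ + mutI f A (C ∪ D) ∅ + 3 * mutI f C D A + mutI f C D B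

/-- `f` satisfies the information constraints of the graph:
`f(N⁻(j) ∪ {j}) = f(N⁻(j))` for every vertex `j`. -/
def FConstraints {V : Type*} [Fintype V] [DecidableEq V]
    (E : V → V → Prop) [DecidableRel E] (f : Finset V → ℝ) : Prop :=
  ∀ j : V, f (insert j (inNbr E j)) = f (inNbr E j)

/-- The S-entropy `E_S(G)`: the maximal value of `f(V)` over normalized S-entropy-like
functions satisfying the information constraints of `G`. -/
noncomputable def SEnt {V : Type*} [Fintype V] [DecidableEq V]
    (E : V → V → Prop) [DecidableRel E] : ℝ :=
  sSup {h : ℝ | ∃ f : Finset V → ℝ,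
    SEntLike f ∧ (∀ j : V, f {j} ≤ 1) ∧ FConstraints E f ∧ h = f Finset.univ}

/-- The ZY-entropy `E_ZY(G)`. -/
noncomputable def ZYEnt {V : Type*} [Fintype V] [DecidableEq V]
    (E : V → V → Prop) [DecidableRel E] : ℝ :=
  sSup {h : ℝ | ∃ f : Finset V → ℝ,
    ZYEntLike f ∧ (∀ j : V, f {j} ≤ 1) ∧ FConstraints E f ∧ h = f Finset.univ}

/-! ## Acyclicity -/

/-- The subgraph induced on `S` is acyclic: no directed cycle within `S`. -/
def AcyclicOn {V : Type*} (E : V → V → Prop) (S : Finset V) : Prop :=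
  ∀ v ∈ S, ¬ Relation.TransGen (fun a b => a ∈ S ∧ b ∈ S ∧ E a b) v v

/-- The acyclic independence number: the maximal size of a vertex set inducing an
acyclic subgraph. -/
noncomputable def acycIndepNum {V : Type*} [Fintype V] (E : V → V → Prop) : ℕ :=
  sSup {k : ℕ | ∃ S : Finset V, AcyclicOn E S ∧ k = S.card}

/-! ## Index codes -/

/-- An index code protocol: a broadcast map `Φ` together with decoding functions `d j`
(depending only on the in-neighbour values and the broadcast message) recovering `x j`. -/
def IsIndexCode {V A W : Type*} (E : V → V → Prop)
    (Φ : (V → A) → W) (d : V → (V → A) → W → A) : Prop :=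
  (∀ (j : V) (x y : V → A) (w : W), (∀ i, E i j → x i = y i) → d j x w = d j y w) ∧
  ∀ (x : V → A) (j : V), d j x (Φ x) = x j

/-- The length `log_s |Φ(A^V)|` of an index code protocol. -/
noncomputable def protocolLength {V A W : Type*} [Fintype V] [DecidableEq V] [Fintype A]
    [Fintype W] [DecidableEq W] (s : ℕ) (Φ : (V → A) → W) : ℝ :=
  Real.logb s ((Finset.univ.image Φ).card)

/-- The base-`s` entropy of the broadcast message `Φ(x)` for `x` uniform on `A^V`. -/
noncomputable def protocolEntropy {V A W : Type*} [Fintype V] [DecidableEq V] [Fintype A]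
    [DecidableEq A] [Fintype W] [DecidableEq W] (s : ℕ) (Φ : (V → A) → W) : ℝ :=
  (∑ w : W, Real.negMulLog
    (((Finset.univ.filter (fun x : V → A => Φ x = w)).card : ℝ) / (s : ℝ) ^ Fintype.card V))
    / Real.log s

/-- `i(G,s)`: the minimal length of an index code for `G` over `Fin s`. -/
noncomputable def indexCodeLen {V : Type*} [Fintype V] [DecidableEq V]
    (E : V → V → Prop) [DecidableRel E] (s : ℕ) : ℝ :=
  sInf {h : ℝ | ∃ (W : Type) (iW : Fintype W) (dW : DecidableEq W)
    (Φ : (V → Fin s) → W) (d : V → (V → Fin s) → W → Fin s),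
    IsIndexCode E Φ d ∧ h = @protocolLength V (Fin s) W _ _ _ iW dW s Φ}

/-- `i_entro(G,s)`: the minimal entropy of an index code for `G` over `Fin s`. -/
noncomputable def indexCodeEntro {V : Type*} [Fintype V] [DecidableEq V]
    (E : V → V → Prop) [DecidableRel E] (s : ℕ) : ℝ :=
  sInf {h : ℝ | ∃ (W : Type) (iW : Fintype W) (dW : DecidableEq W)
    (Φ : (V → Fin s) → W) (d : V → (V → Fin s) → W → Fin s),
    IsIndexCode E Φ d ∧ h = @protocolEntropy V (Fin s) W _ _ _ _ iW dW s Φ}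

/-- The information constraints on `V ∪ {w}` (`w = none`) used to define the S/ZY-minimal
index code: `f(N⁻(j) ∪ {w} ∪ {j}) = f(N⁻(j) ∪ {w})` for each `j`, `f(V ∪ {w}) = f(V)`
and `f(V) = n`. -/
def WConstraints {V : Type*} [Fintype V] [DecidableEq V]
    (E : V → V → Prop) [DecidableRel E] (f : Finset (Option V) → ℝ) : Prop :=
  (∀ j : V, f (insert (some j) (insert none ((inNbr E j).image some)))
      = f (insert none ((inNbr E j).image some))) ∧
  f (insert none ((Finset.univ : Finset V).image some))
      = f ((Finset.univ : Finset V).image some) ∧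
  f ((Finset.univ : Finset V).image some) = (Fintype.card V : ℝ)

/-- The S-minimal index code `i_S(G)`. -/
noncomputable def iS {V : Type*} [Fintype V] [DecidableEq V]
    (E : V → V → Prop) [DecidableRel E] : ℝ :=
  sInf {h : ℝ | ∃ f : Finset (Option V) → ℝ,
    SEntLike f ∧ (∀ j : V, f {some j} ≤ 1) ∧ WConstraints E f ∧ h = f {none}}

/-- The ZY-minimal index code `i_ZY(G)`. -/
noncomputable def iZY {V : Type*} [Fintype V] [DecidableEq V]
    (E : V → V → Prop) [DecidableRel E] : ℝ :=
  sInf {h : ℝ | ∃ f : Finset (Option V) → ℝ,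
    ZYEntLike f ∧ (∀ j : V, f {some j} ≤ 1) ∧ WConstraints E f ∧ h = f {none}}

/-! ## The bidirected pentagon `C5` -/

/-- The pentagon with bidirected edges: vertices `Fin 5`, edges between cyclically
adjacent vertices. -/
def E5 : Fin 5 → Fin 5 → Prop := fun i j => (i.1 + 1) % 5 = j.1 ∨ (j.1 + 1) % 5 = i.1

instance : DecidableRel E5 := fun i j => by unfold E5; infer_instance

/-- The probability, under `p`, that the coordinates in `S` agree with those of `x`. -/
noncomputable def agreeProb {V A : Type*} [Fintype V] [DecidableEq V] [Fintype A] [DecidableEq A]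
    (p : (V → A) → ℝ) (S : Finset V) (x : V → A) : ℝ :=
  marginalPMF p S (fun i => x i.1)

section AgreeProb

variable {V A : Type*} [Fintype V] [DecidableEq V] [Fintype A] [DecidableEq A]

lemma agreeProb_eq_sum (p : (V → A) → ℝ) (S : Finset V) (x : V → A) :
    agreeProb p S x = ∑ y : V → A, if ∀ i ∈ S, y i = x i then p y else 0 := by
  simp only [agreeProb, marginalPMF, Subtype.forall]

lemma agreeProb_univ (p : (V → A) → ℝ) (x : V → A) : agreeProb p Finset.univ x = p x := by
  rw [agreeProb_eq_sum]
  simp [← funext_iff]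

lemma agreeProb_anti {p : (V → A) → ℝ} (hp : ∀ x, 0 ≤ p x) {S T : Finset V} (hST : S ⊆ T)
    (x : V → A) : agreeProb p T x ≤ agreeProb p S x := by
  rw [agreeProb_eq_sum, agreeProb_eq_sum]
  refine Finset.sum_le_sum fun y _ => ?_
  split_ifs with h₁ h₂ h₂
  · exact le_rfl
  · exact absurd (fun i hi => h₁ i (hST hi)) h₂
  · exact hp y
  · exact le_rfl

lemma le_agreeProb {p : (V → A) → ℝ} (hp : ∀ x, 0 ≤ p x) (S : Finset V) (x : V → A) :
    p x ≤ agreeProb p S x := by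
  have h := agreeProb_anti hp (Finset.subset_univ S) x
  rwa [agreeProb_univ] at h

/-- The entropy of a marginal is the expected information content of the coordinates in `S`. -/
lemma Hent_eq_sum (s : ℕ) (p : (V → A) → ℝ) (S : Finset V) :
    Hent s p S = (∑ x : V → A, -(p x * Real.log (agreeProb p S x))) / Real.log s := by
  unfold Hent
  congr 1
  rw [← Finset.sum_fiberwise Finset.univ (fun (x : V → A) (i : ↥S) => x i.1)]
  refine Finset.sum_congr rfl fun y _ => ?_
  have hy : ∑ x : V → A with (fun i : ↥S => x i.1) = y, -(p x * Real.log (agreeProb p S x)) =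
      ∑ x : V → A with (fun i : ↥S => x i.1) = y, -(p x * Real.log (marginalPMF p S y)) := by
    refine Finset.sum_congr rfl fun x hx => ?_
    rw [agreeProb, (Finset.mem_filter.1 hx).2]
  have hm : marginalPMF p S y = ∑ x : V → A with (fun i : ↥S => x i.1) = y, p x := by
    simp only [marginalPMF, Finset.sum_filter, funext_iff]
  rw [hy, Finset.sum_neg_distrib, ← Finset.sum_mul, ← hm, Real.negMulLog, neg_mul]

/-- If enlarging `S` to `T` does not increase the entropy, then the coordinates in `T` are
determined by those in `S` on the support of `p`. -/
lemma eq_of_Hent_eq {s : ℕ} (hs : 2 ≤ s) {p : (V → A) → ℝ} (hp : ∀ x, 0 ≤ p x)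
    {S T : Finset V} (hST : S ⊆ T) (hH : Hent s p T = Hent s p S) {x y : V → A}
    (hx : 0 < p x) (hy : 0 < p y) (hxy : ∀ i ∈ S, y i = x i) : ∀ i ∈ T, y i = x i := by
  have hlog : 0 < Real.log s := Real.log_pos (by exact_mod_cast hs)
  rw [Hent_eq_sum, Hent_eq_sum, div_left_inj' hlog.ne'] at hH
  have hle : ∀ z ∈ (Finset.univ : Finset (V → A)),
      -(p z * Real.log (agreeProb p S z)) ≤ -(p z * Real.log (agreeProb p T z)) := by
    intro z _
    rcases (hp z).eq_or_lt with hz | hz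
    · simp [← hz]
    · have := Real.log_le_log (hz.trans_le (le_agreeProb hp T z)) (agreeProb_anti hp hST z)
      nlinarith
  have heq := (Finset.sum_eq_sum_iff_of_le hle).1 hH.symm x (Finset.mem_univ x)
  have hP : agreeProb p S x = agreeProb p T x :=
    Real.log_injOn_pos (hx.trans_le (le_agreeProb hp S x)) (hx.trans_le (le_agreeProb hp T x))
      (mul_left_cancel₀ hx.ne' (neg_injective heq))
  by_contra hne
  refine hP.not_gt ?_
  rw [agreeProb_eq_sum, agreeProb_eq_sum]
  refine Finset.sum_lt_sum (fun z _ => ?_) ⟨y, Finset.mem_univ y, ?_⟩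
  · split_ifs with h₁ h₂ h₂
    · exact le_rfl
    · exact absurd (fun i hi => h₁ i (hST hi)) h₂
    · exact hp z
    · exact le_rfl
  · rwa [if_neg hne, if_pos hxy]

/-- If the coordinates in `T` are determined by those in `S` on the support of `p`, then the
marginals on `S` and `T` have the same entropy. -/
lemma Hent_eq_of_determined (s : ℕ) {p : (V → A) → ℝ} {S T : Finset V} (hST : S ⊆ T)
    (h : ∀ x y, p x ≠ 0 → p y ≠ 0 → (∀ i ∈ S, y i = x i) → ∀ i ∈ T, y i = x i) :
    Hent s p T = Hent s p S := by
  rw [Hent_eq_sum, Hent_eq_sum]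
  congr 1
  refine Finset.sum_congr rfl fun x _ => ?_
  by_cases hx : p x = 0
  · simp [hx]
  suffices hP : agreeProb p T x = agreeProb p S x by rw [hP]
  rw [agreeProb_eq_sum, agreeProb_eq_sum]
  refine Finset.sum_congr rfl fun y _ => ?_
  by_cases hy : p y = 0
  · simp [hy]
  exact if_congr ⟨fun hT i hi => hT i (hST hi), h x y hx hy⟩ rfl rfl

/-- The entropy is at most the logarithm of the size of a set carrying the distribution. -/
lemma Hent_univ_le_logb_card {s : ℕ} (hs : 2 ≤ s) {p : (V → A) → ℝ} (hp : IsProbDist p)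
    {C : Finset (V → A)} (hC : ∀ x, 0 < p x → x ∈ C) :
    Hent s p Finset.univ ≤ Real.logb s C.card := by
  have hlog : 0 < Real.log s := Real.log_pos (by exact_mod_cast hs)
  have hout : ∀ x ∉ C, p x = 0 := fun x hx =>
    ((hp.1 x).eq_or_lt.resolve_right fun h => hx (hC x h)).symm
  have hsum : ∑ x ∈ C, p x = 1 := by
    rw [← hp.2]
    exact Finset.sum_subset (Finset.subset_univ C) fun x _ hx => hout x hx
  have hne : C.Nonempty := by
    by_contra h
    simp [Finset.not_nonempty_iff_eq_empty.1 h] at hsum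
  have hK : (0 : ℝ) < C.card := by exact_mod_cast hne.card_pos
  rw [Hent_eq_sum, Real.logb]
  refine div_le_div_of_nonneg_right ?_ hlog.le
  simp only [agreeProb_univ]
  rw [← Finset.sum_subset (Finset.subset_univ C) fun x _ hx => by simp [hout x hx]]
  have hterm : ∀ x ∈ C, -(p x * Real.log (p x)) ≤
      p x * Real.log C.card + ((C.card : ℝ)⁻¹ - p x) := by
    intro x _
    rcases (hp.1 x).eq_or_lt with hx | hx
    · simp [← hx]
    · have h := Real.log_le_sub_one_of_pos (inv_pos.2 (mul_pos hx hK))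
      rw [Real.log_inv, Real.log_mul hx.ne' hK.ne'] at h
      have h' := mul_le_mul_of_nonneg_left h hx.le
      have hcancel : p x * ((p x * C.card)⁻¹ - 1) = (C.card : ℝ)⁻¹ - p x := by
        field_simp
      linarith
  refine (Finset.sum_le_sum hterm).trans_eq ?_
  rw [Finset.sum_add_distrib, ← Finset.sum_mul, hsum, Finset.sum_sub_distrib, hsum,
    Finset.sum_const, nsmul_eq_mul, mul_inv_cancel₀ hK.ne']
  ring

/-- The uniform distribution on a set of assignments. -/
noncomputable def uniformOn (C : Finset (V → A)) (x : V → A) : ℝ :=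
  if x ∈ C then (C.card : ℝ)⁻¹ else 0

omit [DecidableEq V] [Fintype A] in
lemma mem_of_uniformOn_ne_zero {C : Finset (V → A)} {x : V → A} (hx : uniformOn C x ≠ 0) :
    x ∈ C := by
  by_contra h
  exact hx (if_neg h)

lemma isProbDist_uniformOn {C : Finset (V → A)} (hC : C.Nonempty) :
    IsProbDist (uniformOn C) := by
  have hK : (C.card : ℝ) ≠ 0 := by exact_mod_cast hC.card_pos.ne'
  refine ⟨fun x => ?_, ?_⟩
  · unfold uniformOn
    split_ifs <;> positivity
  · simp [uniformOn, hK]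

lemma Hent_univ_uniformOn (s : ℕ) {C : Finset (V → A)} (hC : C.Nonempty) :
    Hent s (uniformOn C) Finset.univ = Real.logb s C.card := by
  have hK : (C.card : ℝ) ≠ 0 := by exact_mod_cast hC.card_pos.ne'
  rw [Hent_eq_sum, Real.logb]
  congr 1
  have hterm : ∀ x, -(uniformOn C x * Real.log (agreeProb (uniformOn C) Finset.univ x)) =
      uniformOn C x * Real.log C.card := by
    intro x
    rw [agreeProb_univ]
    by_cases hx : x ∈ C <;> simp [uniformOn, hx]
  rw [Finset.sum_congr rfl fun x _ => hterm x, ← Finset.sum_mul, (isProbDist_uniformOn hC).2,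
    one_mul]

lemma infoConstraints_uniformOn_correctSet (E : V → V → Prop) [DecidableRel E] (s : ℕ)
    {g : V → (V → A) → A} (hg : IsStrategy E g) :
    InfoConstraints E s (uniformOn (correctSet g)) := by
  intro j
  rw [sub_eq_zero]
  refine Hent_eq_of_determined s (Finset.subset_insert _ _) fun x y hx hy hxy i hi => ?_
  rcases Finset.mem_insert.1 hi with rfl | hi
  · have hx' := (Finset.mem_filter.1 (mem_of_uniformOn_ne_zero hx)).2 i
    have hy' := (Finset.mem_filter.1 (mem_of_uniformOn_ne_zero hy)).2 i
    rw [← hx', ← hy']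
    exact hg i y x fun k hk => hxy k (by simpa [inNbr] using hk)
  · exact hxy i hi

/-- For a distribution satisfying the information constraints there is a strategy that is correct
on its whole support. -/
lemma exists_strategy_of_infoConstraints (E : V → V → Prop) [DecidableRel E] {s : ℕ}
    (hs : 2 ≤ s) {p : (V → A) → ℝ} (hp : ∀ x, 0 ≤ p x) (hI : InfoConstraints E s p)
    [Nonempty A] :
    ∃ g : V → (V → A) → A, IsStrategy E g ∧ ∀ x, 0 < p x → x ∈ correctSet g := by
  refine ⟨fun j x => Classical.epsilon (fun y : V → A => 0 < p y ∧ ∀ i, E i j → y i = x i) j,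
    fun j x y hxy => ?_, fun x hx => ?_⟩
  · have h : (fun z : V → A => 0 < p z ∧ ∀ i, E i j → z i = x i) =
        fun z => 0 < p z ∧ ∀ i, E i j → z i = y i := by
      funext z
      refine propext (and_congr_right fun _ => forall₂_congr fun i hi => ?_)
      rw [hxy i hi]
    simp only [h]
  · refine Finset.mem_filter.2 ⟨Finset.mem_univ x, fun j => ?_⟩
    have h := Classical.epsilon_spec
      (p := fun y : V → A => 0 < p y ∧ ∀ i, E i j → y i = x i) ⟨x, hx, fun _ _ => rfl⟩
    exact eq_of_Hent_eq hs hp (Finset.subset_insert j (inNbr E j)) (sub_eq_zero.1 (hI j)) hx h.1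
      (fun i hi => h.2 i (by simpa [inNbr] using hi)) j (Finset.mem_insert_self _ _)

end AgreeProb

section MaxCorrect

variable {V : Type*} [Fintype V] [DecidableEq V] (E : V → V → Prop) [DecidableRel E]

omit [DecidableRel E] in
lemma bddAbove_correct (s : ℕ) : BddAbove
    {m : ℕ | ∃ g : V → (V → Fin s) → Fin s, IsStrategy E g ∧ m = (correctSet g).card} :=
  ⟨Fintype.card (V → Fin s), by rintro m ⟨g, -, rfl⟩; exact Finset.card_le_univ _⟩

lemma card_correctSet_le_maxCorrect {s : ℕ} {g : V → (V → Fin s) → Fin s}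
    (hg : IsStrategy E g) : (correctSet g).card ≤ maxCorrect E s :=
  le_csSup (bddAbove_correct E s) ⟨g, hg, rfl⟩

lemma exists_card_correctSet_eq_maxCorrect {s : ℕ} (hs : 2 ≤ s) :
    ∃ g : V → (V → Fin s) → Fin s, IsStrategy E g ∧ maxCorrect E s = (correctSet g).card := by
  have hne : {m : ℕ | ∃ g : V → (V → Fin s) → Fin s,
      IsStrategy E g ∧ m = (correctSet g).card}.Nonempty :=
    ⟨_, fun _ _ => ⟨0, by omega⟩, fun _ _ _ _ => rfl, rfl⟩
  exact Nat.sSup_mem hne (bddAbove_correct E s)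

lemma maxCorrect_pos {s : ℕ} (hs : 2 ≤ s) : 0 < maxCorrect E s := by
  let a : Fin s := ⟨0, by omega⟩
  have h : (fun _ => a) ∈ correctSet fun (_ : V) (_ : V → Fin s) => a := by
    simp [correctSet]
  exact (Finset.card_pos.2 ⟨_, h⟩).trans_le
    (card_correctSet_le_maxCorrect E fun _ _ _ _ => rfl)

lemma guessingNumber_eq_logb {s : ℕ} (hs : 2 ≤ s) :
    guessingNumber E s = Real.logb s (maxCorrect E s) := by
  have hs' : (1 : ℝ) < s := by exact_mod_cast hs
  have hm : (maxCorrect E s : ℝ) ≠ 0 := by exact_mod_cast (maxCorrect_pos E hs).ne'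
  rw [guessingNumber, maxProb, Real.logb_div hm (by positivity), Real.logb_pow,
    Real.logb_self_eq_one hs']
  ring

/-- Over every alphabet the entropy of the graph equals its guessing number. -/
lemma graphEntropy_eq_guessingNumber {s : ℕ} (hs : 2 ≤ s) :
    graphEntropy E s = guessingNumber E s := by
  rw [guessingNumber_eq_logb E hs]
  refine IsGreatest.csSup_eq ⟨?_, ?_⟩
  · obtain ⟨g, hg, hcard⟩ := exists_card_correctSet_eq_maxCorrect E hs
    have hne : (correctSet g).Nonempty := Finset.card_pos.1 (hcard ▸ maxCorrect_pos E hs)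
    exact ⟨uniformOn (correctSet g), isProbDist_uniformOn hne,
      infoConstraints_uniformOn_correctSet E s hg, by rw [Hent_univ_uniformOn s hne, hcard]⟩
  · rintro h ⟨p, hp, hI, rfl⟩
    have : Nonempty (Fin s) := ⟨⟨0, by omega⟩⟩
    obtain ⟨g, hg, hsupp⟩ := exists_strategy_of_infoConstraints E hs hp.1 hI
    refine (Hent_univ_le_logb_card hs hp hsupp).trans ?_
    obtain ⟨x, hx⟩ : ∃ x, 0 < p x := by
      by_contra! hle
      have := hp.2
      have := Finset.sum_nonpos fun x (_ : x ∈ Finset.univ) => hle x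
      linarith
    have hpos : (0 : ℝ) < (correctSet g).card := by
      exact_mod_cast Finset.card_pos.2 ⟨x, hsupp x hx⟩
    exact Real.logb_le_logb_of_le (by exact_mod_cast hs) hpos
      (by exact_mod_cast card_correctSet_le_maxCorrect E hg)

end MaxCorrect

/-- For every finite directed graph `G`, the general entropy equals the
general guessing number: `E(G) = g(G)`. -/
theorem genEntropy_eq_genGuessing {V : Type} [Fintype V] [DecidableEq V]
    (E : V → V → Prop) [DecidableRel E] :
    genEntropy E = genGuessing E := by
  unfold genEntropy genGuessing
  congr 1
  ext h
  exact exists_congr fun s => and_congr_right fun hs => by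
    rw [graphEntropy_eq_guessingNumber E hs]
end

section
/- For every finite directed graph G and every integer s ≥ 2: i(G,s) ≥ i_entro(G,s) ≥ i_ZY(G) ≥ i_S(G), i.e. the length of the minimal index code is at least the minimal entropy of an index code, which is at least the ZY-minimal index code, which is at least the S-minimal index code. -/
open Finset

/-! ## Entropy of partitions of a finite weighted set -/

section PartitionEntropy

variable {Ω Ω' : Type*} [Fintype Ω] [Fintype Ω']

open Classical in
/-- The total weight of the `r`-class of `ω`. -/
noncomputable def classWeight (p : Ω → ℝ) (r : Setoid Ω) (ω : Ω) : ℝ :=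
  ∑ α, p α * if r ω α then 1 else 0

/-- The entropy (in nats) of the partition of `Ω` into the classes of `r`. -/
noncomputable def partEntropy (p : Ω → ℝ) (r : Setoid Ω) : ℝ :=
  -∑ ω, p ω * Real.log (classWeight p r ω)

lemma classWeight_congr_rel (p : Ω → ℝ) (r : Setoid Ω) {ω ω' : Ω} (h : r ω ω') :
    classWeight p r ω = classWeight p r ω' := by
  classical
  refine Finset.sum_congr rfl fun α _ => ?_
  have : r ω α ↔ r ω' α := ⟨fun k => r.trans (r.symm h) k, fun k => r.trans h k⟩
  simp [this]

lemma classWeight_nonneg {p : Ω → ℝ} (hp : ∀ ω, 0 ≤ p ω) (r : Setoid Ω) (ω : Ω) :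
    0 ≤ classWeight p r ω := by
  classical
  refine Finset.sum_nonneg fun α _ => mul_nonneg (hp α) ?_
  split_ifs <;> norm_num

lemma le_classWeight {p : Ω → ℝ} (hp : ∀ ω, 0 ≤ p ω) (r : Setoid Ω) (ω : Ω) :
    p ω ≤ classWeight p r ω := by
  classical
  have h := Finset.single_le_sum (f := fun α => p α * if r ω α then (1 : ℝ) else 0)
    (fun α _ => mul_nonneg (hp α) (by split_ifs <;> norm_num)) (Finset.mem_univ ω)
  simpa [classWeight, r.refl ω] using h

lemma classWeight_anti {p : Ω → ℝ} (hp : ∀ ω, 0 ≤ p ω) {r t : Setoid Ω} (h : r ≤ t) (ω : Ω) :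
    classWeight p r ω ≤ classWeight p t ω := by
  classical
  refine Finset.sum_le_sum fun α _ => mul_le_mul_of_nonneg_left ?_ (hp α)
  by_cases hr : r ω α
  · simp [hr, h hr]
  · simp only [hr, if_false]
    split_ifs <;> norm_num

lemma partEntropy_top {p : Ω → ℝ} (h1 : ∑ ω, p ω = 1) : partEntropy p ⊤ = 0 := by
  classical
  have : ∀ ω, classWeight p ⊤ ω = 1 := fun ω => by simp [classWeight, h1]
  simp [partEntropy, this]

lemma partEntropy_anti {p : Ω → ℝ} (hp : ∀ ω, 0 ≤ p ω) {r t : Setoid Ω} (h : r ≤ t) :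
    partEntropy p t ≤ partEntropy p r := by
  refine neg_le_neg (Finset.sum_le_sum fun ω _ => ?_)
  rcases (hp ω).eq_or_lt with h0 | h0
  · simp [← h0]
  · exact mul_le_mul_of_nonneg_left
      (Real.log_le_log (h0.trans_le (le_classWeight hp r ω)) (classWeight_anti hp h ω)) h0.le

lemma sum_div_classWeight_le {p : Ω → ℝ} (hp : ∀ ω, 0 ≤ p ω) (r s t : Setoid Ω) (α β : Ω) :
    (open Classical in ∑ ω, p ω * ((if (r ⊓ t) ω α then (1 : ℝ) else 0) *
        (if (s ⊓ t) ω β then 1 else 0) /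
        (classWeight p (r ⊓ s ⊓ t) ω * classWeight p t ω)))
      ≤ (open Classical in if t α β then 1 else 0) / classWeight p t α := by
  classical
  by_cases hex : ∃ ω₀, (r ⊓ t) ω₀ α ∧ (s ⊓ t) ω₀ β
  · obtain ⟨ω₀, hα, hβ⟩ := hex
    have hαβ : t α β := t.trans (t.symm hα.2) hβ.2
    have key : ∀ ω, p ω * ((if (r ⊓ t) ω α then (1 : ℝ) else 0) *
        (if (s ⊓ t) ω β then 1 else 0) /
        (classWeight p (r ⊓ s ⊓ t) ω * classWeight p t ω)) =
        (p ω * if (r ⊓ s ⊓ t) ω₀ ω then 1 else 0) /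
        (classWeight p (r ⊓ s ⊓ t) ω₀ * classWeight p t α) := by
      intro ω
      by_cases h : (r ⊓ s ⊓ t) ω₀ ω
      · have h1 : (r ⊓ t) ω α := (r ⊓ t).trans ⟨r.symm h.1.1, t.symm h.2⟩ hα
        have h2 : (s ⊓ t) ω β := (s ⊓ t).trans ⟨s.symm h.1.2, t.symm h.2⟩ hβ
        rw [← classWeight_congr_rel p _ h, classWeight_congr_rel p t h1.2]
        simp only [h, h1, h2, if_true]
        ring
      · have : ¬ ((r ⊓ t) ω α ∧ (s ⊓ t) ω β) := fun k =>
          h ⟨⟨r.trans hα.1 (r.symm k.1.1), s.trans hβ.1 (s.symm k.2.1)⟩,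
            t.trans hα.2 (t.symm k.1.2)⟩
        simp only [h, if_false, mul_zero, zero_div]
        by_cases k : (r ⊓ t) ω α
        · have k' : ¬ (s ⊓ t) ω β := fun k' => this ⟨k, k'⟩
          simp [k']
        · simp [k]
    rw [Finset.sum_congr rfl fun ω _ => key ω, ← Finset.sum_div]
    change classWeight p (r ⊓ s ⊓ t) ω₀ / _ ≤ _
    rw [if_pos hαβ, ← div_div]
    exact div_le_div_of_nonneg_right (div_self_le_one _) (classWeight_nonneg hp t α)
  · rw [Finset.sum_eq_zero]
    · exact div_nonneg (by split_ifs <;> norm_num) (classWeight_nonneg hp t α)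
    · intro ω _
      by_cases k : (r ⊓ t) ω α
      · have k' : ¬ (s ⊓ t) ω β := fun k' => hex ⟨ω, k, k'⟩
        simp [k']
      · simp [k]

lemma sum_classWeight_ratio_le {p : Ω → ℝ} (hp : ∀ ω, 0 ≤ p ω) (r s t : Setoid Ω) :
    ∑ ω, p ω * (classWeight p (r ⊓ t) ω * classWeight p (s ⊓ t) ω /
      (classWeight p (r ⊓ s ⊓ t) ω * classWeight p t ω)) ≤ ∑ ω, p ω := by
  classical
  calc ∑ ω, p ω * (classWeight p (r ⊓ t) ω * classWeight p (s ⊓ t) ω /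
        (classWeight p (r ⊓ s ⊓ t) ω * classWeight p t ω))
      = ∑ ω, ∑ α, ∑ β, p α * p β * (p ω * ((if (r ⊓ t) ω α then (1 : ℝ) else 0) *
        (if (s ⊓ t) ω β then 1 else 0) /
        (classWeight p (r ⊓ s ⊓ t) ω * classWeight p t ω))) := by
        refine Finset.sum_congr rfl fun ω _ => ?_
        generalize classWeight p (r ⊓ s ⊓ t) ω * classWeight p t ω = D
        simp only [classWeight]
        rw [Finset.sum_mul_sum, Finset.sum_div, Finset.mul_sum]
        refine Finset.sum_congr rfl fun α _ => ?_
        rw [Finset.sum_div, Finset.mul_sum]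
        refine Finset.sum_congr rfl fun β _ => ?_
        ring
    _ = ∑ α, ∑ β, p α * p β * ∑ ω, p ω * ((if (r ⊓ t) ω α then (1 : ℝ) else 0) *
        (if (s ⊓ t) ω β then 1 else 0) /
        (classWeight p (r ⊓ s ⊓ t) ω * classWeight p t ω)) := by
        rw [Finset.sum_comm]
        refine Finset.sum_congr rfl fun α _ => ?_
        rw [Finset.sum_comm]
        exact Finset.sum_congr rfl fun β _ => (Finset.mul_sum _ _ _).symm
    _ ≤ ∑ α, ∑ β, p α * p β * ((if t α β then 1 else 0) / classWeight p t α) :=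
        Finset.sum_le_sum fun α _ => Finset.sum_le_sum fun β _ =>
          mul_le_mul_of_nonneg_left (sum_div_classWeight_le hp r s t α β)
            (mul_nonneg (hp α) (hp β))
    _ = ∑ α, p α * (classWeight p t α / classWeight p t α) := by
        refine Finset.sum_congr rfl fun α _ => ?_
        conv_rhs => rw [classWeight]
        rw [Finset.sum_div, Finset.mul_sum]
        refine Finset.sum_congr rfl fun β _ => ?_
        rw [classWeight]
        ring
    _ ≤ ∑ α, p α := Finset.sum_le_sum fun α _ =>
        mul_le_of_le_one_right (hp α) (div_self_le_one _)

lemma partEntropy_submod {p : Ω → ℝ} (hp : ∀ ω, 0 ≤ p ω) (r s t : Setoid Ω) :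
    partEntropy p (r ⊓ s ⊓ t) + partEntropy p t
      ≤ partEntropy p (r ⊓ t) + partEntropy p (s ⊓ t) := by
  have hterm : ∀ ω, p ω * Real.log (classWeight p (r ⊓ t) ω)
      + p ω * Real.log (classWeight p (s ⊓ t) ω) + p ω
      ≤ p ω * Real.log (classWeight p (r ⊓ s ⊓ t) ω) + p ω * Real.log (classWeight p t ω)
        + p ω * (classWeight p (r ⊓ t) ω * classWeight p (s ⊓ t) ω /
      (classWeight p (r ⊓ s ⊓ t) ω * classWeight p t ω)) := by
    intro ω
    rcases (hp ω).eq_or_lt with h0 | h0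
    · simp [← h0]
    · have pos : ∀ u : Setoid Ω, 0 < classWeight p u ω := fun u =>
        h0.trans_le (le_classWeight hp u ω)
      have h := Real.log_le_sub_one_of_pos (div_pos (mul_pos (pos (r ⊓ t)) (pos (s ⊓ t)))
        (mul_pos (pos (r ⊓ s ⊓ t)) (pos t)))
      rw [Real.log_div (mul_pos (pos _) (pos _)).ne' (mul_pos (pos _) (pos _)).ne',
        Real.log_mul (pos _).ne' (pos _).ne', Real.log_mul (pos _).ne' (pos _).ne'] at h
      nlinarith [mul_le_mul_of_nonneg_left h h0.le]
  have hsum := Finset.sum_le_sum fun ω (_ : ω ∈ Finset.univ) => hterm ω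
  simp only [Finset.sum_add_distrib] at hsum
  have := sum_classWeight_ratio_le hp r s t
  simp only [partEntropy]
  linarith

lemma partEntropy_congr {p : Ω → ℝ} {r t : Setoid Ω}
    (h : ∀ x y, p x ≠ 0 → p y ≠ 0 → (r x y ↔ t x y)) : partEntropy p r = partEntropy p t := by
  classical
  refine congrArg Neg.neg (Finset.sum_congr rfl fun x _ => ?_)
  by_cases hx : p x = 0
  · simp [hx]
  · have : classWeight p r x = classWeight p t x := Finset.sum_congr rfl fun y _ => by
      by_cases hy : p y = 0
      · simp [hy]
      · simp [h x y hx hy]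
    rw [this]

lemma partEntropy_comap {p : Ω → ℝ} {q : Ω' → ℝ} {π : Ω' → Ω}
    (hπ : ∀ F : Ω → ℝ, ∑ x, q x * F (π x) = ∑ ω, p ω * F ω) (r : Setoid Ω) :
    partEntropy q (r.comap π) = partEntropy p r := by
  classical
  have hc : ∀ x, classWeight q (r.comap π) x = classWeight p r (π x) := fun x => by
    simpa [classWeight, Setoid.comap_rel] using hπ fun α => if r (π x) α then 1 else 0
  simp only [partEntropy, hc]
  rw [hπ fun ω => Real.log (classWeight p r ω)]

open Classical in
/-- The coupling of two copies of `(Ω, p)` which are equal modulo `m` and conditionally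
independent given the class of `m`. -/
noncomputable def copyWeight (p : Ω → ℝ) (m : Setoid Ω) (x : Ω × Ω) : ℝ :=
  p x.1 * p x.2 * (if m x.1 x.2 then 1 else 0) / classWeight p m x.1

lemma copyWeight_nonneg {p : Ω → ℝ} (hp : ∀ ω, 0 ≤ p ω) (m : Setoid Ω) (x : Ω × Ω) :
    0 ≤ copyWeight p m x :=
  div_nonneg (mul_nonneg (mul_nonneg (hp _) (hp _)) (by split_ifs <;> norm_num))
    (classWeight_nonneg hp m _)

lemma rel_of_copyWeight_ne_zero {p : Ω → ℝ} {m : Setoid Ω} {x : Ω × Ω}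
    (h : copyWeight p m x ≠ 0) : m x.1 x.2 := by
  by_contra hm
  simp [copyWeight, hm] at h

lemma copyWeight_swap (p : Ω → ℝ) (m : Setoid Ω) (x : Ω × Ω) :
    copyWeight p m x.swap = copyWeight p m x := by
  by_cases h : m x.1 x.2
  · have h' := m.symm h
    simp [copyWeight, h, h', classWeight_congr_rel p m h, mul_comm]
  · have h' : ¬ m x.2 x.1 := fun k => h (m.symm k)
    simp [copyWeight, h, h']

lemma sum_copyWeight_fst {p : Ω → ℝ} (hp : ∀ ω, 0 ≤ p ω) (m : Setoid Ω) (F : Ω → ℝ) :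
    ∑ x, copyWeight p m x * F x.1 = ∑ ω, p ω * F ω := by
  classical
  rw [Fintype.sum_prod_type]
  refine Finset.sum_congr rfl fun ω _ => ?_
  simp only [← Finset.sum_mul]
  congr 1
  rcases (hp ω).eq_or_lt with h0 | h0
  · simp [copyWeight, ← h0]
  · calc ∑ y, copyWeight p m (ω, y) = p ω * (classWeight p m ω / classWeight p m ω) := by
          conv_rhs => rw [classWeight]
          rw [Finset.sum_div, Finset.mul_sum]
          refine Finset.sum_congr rfl fun y _ => ?_
          simp only [copyWeight, classWeight]
          ring
      _ = p ω := by rw [div_self (h0.trans_le (le_classWeight hp m ω)).ne', mul_one]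

lemma sum_copyWeight_snd {p : Ω → ℝ} (hp : ∀ ω, 0 ≤ p ω) (m : Setoid Ω) (F : Ω → ℝ) :
    ∑ x, copyWeight p m x * F x.2 = ∑ ω, p ω * F ω := by
  rw [← sum_copyWeight_fst hp m F, ← (Equiv.prodComm Ω Ω).sum_comp]
  exact Finset.sum_congr rfl fun x _ => by
    simp only [Equiv.prodComm_apply, copyWeight_swap, Prod.snd_swap]

lemma classWeight_copyWeight {p : Ω → ℝ} {m r t : Setoid Ω} (hr : r ≤ m) (ht : t ≤ m)
    {x : Ω × Ω} (hx : m x.1 x.2) :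
    classWeight (copyWeight p m) (r.comap Prod.fst ⊓ t.comap Prod.snd) x
      = classWeight p r x.1 * classWeight p t x.2 / classWeight p m x.1 := by
  classical
  conv_rhs => rw [classWeight, classWeight, Finset.sum_mul_sum, Finset.sum_div]
  rw [classWeight, Fintype.sum_prod_type]
  refine Finset.sum_congr rfl fun α _ => ?_
  rw [Finset.sum_div]
  refine Finset.sum_congr rfl fun β _ => ?_
  have hrel : (r.comap Prod.fst ⊓ t.comap Prod.snd) x (α, β) ↔ r x.1 α ∧ t x.2 β := Iff.rfl
  by_cases h1 : r x.1 α
  · by_cases h2 : t x.2 β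
    · have hm : m α β := m.trans (m.symm (hr h1)) (m.trans hx (ht h2))
      simp [hrel, h1, h2, copyWeight, hm, classWeight_congr_rel p m (hr h1)]
    · simp [hrel, h2]
  · simp [hrel, h1]

lemma partEntropy_copyWeight {p : Ω → ℝ} (hp : ∀ ω, 0 ≤ p ω) {m r t : Setoid Ω}
    (hr : r ≤ m) (ht : t ≤ m) :
    partEntropy (copyWeight p m) (r.comap Prod.fst ⊓ t.comap Prod.snd)
      = partEntropy p r + partEntropy p t - partEntropy p m := by
  have hterm : ∀ x, copyWeight p m x *
      Real.log (classWeight (copyWeight p m) (r.comap Prod.fst ⊓ t.comap Prod.snd) x)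
      = copyWeight p m x * Real.log (classWeight p r x.1)
        + copyWeight p m x * Real.log (classWeight p t x.2)
        - copyWeight p m x * Real.log (classWeight p m x.1) := by
    intro x
    by_cases hx : copyWeight p m x = 0
    · simp [hx]
    · have hm := rel_of_copyWeight_ne_zero hx
      have h1 : p x.1 ≠ 0 := fun h => hx (by simp [copyWeight, h])
      have h2 : p x.2 ≠ 0 := fun h => hx (by simp [copyWeight, h])
      have pos : ∀ (u : Setoid Ω) (ω : Ω), p ω ≠ 0 → classWeight p u ω ≠ 0 := fun u ω h =>
        (((hp ω).lt_of_ne' h).trans_le (le_classWeight hp u ω)).ne'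
      rw [classWeight_copyWeight hr ht hm,
        Real.log_div (mul_ne_zero (pos _ _ h1) (pos _ _ h2)) (pos _ _ h1),
        Real.log_mul (pos _ _ h1) (pos _ _ h2)]
      ring
  simp only [partEntropy, hterm, Finset.sum_add_distrib, Finset.sum_sub_distrib]
  rw [sum_copyWeight_fst hp m fun ω => Real.log (classWeight p r ω),
    sum_copyWeight_snd hp m fun ω => Real.log (classWeight p t ω),
    sum_copyWeight_fst hp m fun ω => Real.log (classWeight p m ω)]
  ring

/-- The Zhang–Yeung inequality for a submodular function, in the presence of a copy `e` of `a`
over `c ⊓ d` which is conditionally independent of `a ⊓ b` given `c ⊓ d`. -/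
lemma zhangYeung_of_copy {L : Type*} [SemilatticeInf L] (h : L → ℝ)
    (sub : ∀ r s t, h (r ⊓ s ⊓ t) + h t ≤ h (r ⊓ t) + h (s ⊓ t))
    (a b c d e : L)
    (he : h e = h a) (hec : h (e ⊓ c) = h (a ⊓ c)) (hed : h (e ⊓ d) = h (a ⊓ d))
    (hecd : h (e ⊓ c ⊓ d) = h (a ⊓ c ⊓ d))
    (hind : h (a ⊓ b ⊓ e ⊓ c ⊓ d) + h (c ⊓ d) = h (a ⊓ b ⊓ c ⊓ d) + h (e ⊓ c ⊓ d)) :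
    2 * (h c + h d - h (c ⊓ d)) ≤ (h a + h b - h (a ⊓ b)) + (h a + h (c ⊓ d) - h (a ⊓ c ⊓ d))
      + 3 * (h (c ⊓ a) + h (d ⊓ a) - h (c ⊓ d ⊓ a) - h a)
      + (h (c ⊓ b) + h (d ⊓ b) - h (c ⊓ d ⊓ b) - h b) := by
  have h1 := sub a b e
  have h2 := sub e (c ⊓ d) (a ⊓ b)
  have h3 := sub c d (a ⊓ e)
  have h4 := sub c d (b ⊓ e)
  have h5 := sub e a c
  have h6 := sub e a d
  have h7 := sub e b c
  have h8 := sub e b d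
  have h9 := sub e b (c ⊓ d ⊓ a)
  have h10 := sub e a (c ⊓ d ⊓ b)
  simp only [inf_comm, inf_left_comm] at *
  linarith

theorem partEntropy_zhangYeung {p : Ω → ℝ} (hp : ∀ ω, 0 ≤ p ω) (a b c d : Setoid Ω) :
    let h := partEntropy p
    2 * (h c + h d - h (c ⊓ d)) ≤ (h a + h b - h (a ⊓ b)) + (h a + h (c ⊓ d) - h (a ⊓ c ⊓ d))
      + 3 * (h (c ⊓ a) + h (d ⊓ a) - h (c ⊓ d ⊓ a) - h a)
      + (h (c ⊓ b) + h (d ⊓ b) - h (c ⊓ d ⊓ b) - h b) := by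
  intro h
  set q := copyWeight p (c ⊓ d) with hq
  have hq0 : ∀ x, 0 ≤ q x := copyWeight_nonneg hp _
  have hfst : ∀ r : Setoid Ω, partEntropy q (r.comap Prod.fst) = h r :=
    partEntropy_comap (sum_copyWeight_fst hp _)
  have hsnd : ∀ r : Setoid Ω, partEntropy q (r.comap Prod.snd) = h r :=
    partEntropy_comap (sum_copyWeight_snd hp _)
  have hinf : ∀ r t : Setoid Ω,
      r.comap (Prod.fst : Ω × Ω → Ω) ⊓ t.comap Prod.fst = (r ⊓ t).comap Prod.fst :=
    fun _ _ => rfl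
  have hcopy : ∀ r : Setoid Ω, c ⊓ d ≤ r → partEntropy q (a.comap Prod.snd ⊓ r.comap Prod.fst)
      = h (a ⊓ r) := by
    intro r hr
    rw [← hsnd]
    refine partEntropy_congr fun x y hx hy => ?_
    have hx := hr (rel_of_copyWeight_ne_zero hx)
    have hy := hr (rel_of_copyWeight_ne_zero hy)
    refine and_congr_right fun _ => ?_
    exact ⟨fun k => r.trans (r.symm hx) (r.trans k hy),
      fun k => r.trans hx (r.trans k (r.symm hy))⟩
  have hind : partEntropy q (a.comap Prod.fst ⊓ b.comap Prod.fst ⊓ a.comap Prod.snd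
      ⊓ c.comap Prod.fst ⊓ d.comap Prod.fst)
      = h (a ⊓ b ⊓ (c ⊓ d)) + h (a ⊓ (c ⊓ d)) - h (c ⊓ d) := by
    rw [← partEntropy_copyWeight hp (inf_le_right : a ⊓ b ⊓ (c ⊓ d) ≤ c ⊓ d)
      (inf_le_right : a ⊓ (c ⊓ d) ≤ c ⊓ d)]
    refine partEntropy_congr fun x y hx hy => ?_
    have hx := rel_of_copyWeight_ne_zero hx
    have hy := rel_of_copyWeight_ne_zero hy
    constructor
    · rintro ⟨⟨⟨⟨h1, h2⟩, h3⟩, h4⟩, h5⟩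
      exact ⟨⟨⟨h1, h2⟩, h4, h5⟩, h3,
        (c ⊓ d).trans ((c ⊓ d).symm hx) ((c ⊓ d).trans ⟨h4, h5⟩ hy)⟩
    · rintro ⟨⟨⟨h1, h2⟩, h4, h5⟩, h3, -⟩
      exact ⟨⟨⟨⟨h1, h2⟩, h3⟩, h4⟩, h5⟩
  have key := zhangYeung_of_copy (partEntropy q) (partEntropy_submod hq0)
    (a.comap Prod.fst) (b.comap Prod.fst) (c.comap Prod.fst) (d.comap Prod.fst)
    (a.comap Prod.snd) (by rw [hfst, hsnd])
    (by rw [hcopy c inf_le_left, hinf, hfst]) (by rw [hcopy d inf_le_right, hinf, hfst])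
    (by rw [inf_assoc, hinf, hcopy _ le_rfl, hinf, hinf, hfst, inf_assoc])
    (by
      rw [hind, inf_assoc (a.comap Prod.snd), hinf, hinf, hinf, hinf, hcopy _ le_rfl, hfst, hfst,
        inf_assoc (a ⊓ b)]
      ring)
  simpa only [hinf, hfst] using key

open Classical in
lemma partEntropy_ker {T : Type*} (p : Ω → ℝ) (g : Ω → T) (S : Finset T) (hS : ∀ ω, g ω ∈ S) :
    partEntropy p (Setoid.ker g) = ∑ t ∈ S, Real.negMulLog (∑ ω with g ω = t, p ω) := by
  rw [partEntropy, ← Finset.sum_fiberwise_of_maps_to (fun ω _ => hS ω), ← Finset.sum_neg_distrib]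
  refine Finset.sum_congr rfl fun t _ => ?_
  rw [Real.negMulLog, neg_mul, Finset.sum_mul]
  refine congrArg Neg.neg (Finset.sum_congr rfl fun ω hω => ?_)
  have hω : g ω = t := by simpa using hω
  congr 2
  simp [classWeight, Setoid.ker_def, hω, Finset.sum_filter, eq_comm]

lemma partEntropy_ker_le {T : Type*} {p : Ω → ℝ} (hp : ∀ ω, 0 ≤ p ω) (h1 : ∑ ω, p ω = 1)
    (g : Ω → T) (S : Finset T) (hS : ∀ ω, g ω ∈ S) :
    partEntropy p (Setoid.ker g) ≤ Real.log S.card := by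
  classical
  have hne : S.Nonempty := by
    by_contra h
    rw [Finset.not_nonempty_iff_eq_empty] at h
    have : IsEmpty Ω := ⟨fun ω => by simpa [h] using hS ω⟩
    simp at h1
  have hc : (0 : ℝ) < S.card := by exact_mod_cast hne.card_pos
  have hJ := Real.concaveOn_negMulLog.le_map_sum (t := S) (w := fun _ => (S.card : ℝ)⁻¹)
    (p := fun t => ∑ ω with g ω = t, p ω) (fun _ _ => (inv_pos.2 hc).le)
    (by simp [hc.ne']) (fun t _ => Finset.sum_nonneg fun ω _ => hp ω)
  simp only [smul_eq_mul, ← Finset.mul_sum] at hJ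
  rw [← partEntropy_ker p g S hS, Finset.sum_fiberwise_of_maps_to (fun ω _ => hS ω), h1, mul_one,
    Real.negMulLog, Real.log_inv, neg_mul_neg] at hJ
  exact le_of_mul_le_mul_left hJ (inv_pos.2 hc)

/-- The normalized joint entropy of the families of partitions indexed by finite sets is
Zhang–Yeung entropy-like. -/
lemma zyEntLike_partEntropy {U : Type*} [DecidableEq U] {p : Ω → ℝ} (hp : ∀ ω, 0 ≤ p ω)
    (h1 : ∑ ω, p ω = 1) (R : U → Setoid Ω) {k : ℝ} (hk : 0 ≤ k) :
    ZYEntLike fun S : Finset U => partEntropy p (S.inf R) / k := by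
  refine ⟨⟨by simp [partEntropy_top h1], fun X Y hXY => ?_, fun X Y => ?_⟩, fun A B C D => ?_⟩
  · exact div_le_div_of_nonneg_right (partEntropy_anti hp (Finset.inf_mono hXY)) hk
  · have h := partEntropy_submod hp (X.inf R) (Y.inf R) ((X ∩ Y).inf R)
    rw [inf_eq_left.2 (Finset.inf_mono Finset.inter_subset_left : X.inf R ≤ (X ∩ Y).inf R),
      inf_eq_left.2 (Finset.inf_mono Finset.inter_subset_right : Y.inf R ≤ (X ∩ Y).inf R),
      inf_eq_left.2 (inf_le_left.trans
        (Finset.inf_mono Finset.inter_subset_left) : X.inf R ⊓ Y.inf R ≤ (X ∩ Y).inf R)] at h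
    simp only [Finset.inf_union, ← add_div]
    exact div_le_div_of_nonneg_right (by linarith) hk
  · have h := div_le_div_of_nonneg_right
      (partEntropy_zhangYeung hp (A.inf R) (B.inf R) (C.inf R) (D.inf R)) hk
    simp only [mutI, Finset.inf_union, Finset.inf_empty, inf_top_eq, partEntropy_top h1, zero_div,
      sub_zero, ← inf_assoc]
    simp only [add_div, sub_div, mul_div_assoc] at h ⊢
    linarith

end PartitionEntropy

/-! ## Index codes -/

section IndexCode

lemma isIndexCode_id {V A : Type*} (E : V → V → Prop) :
    IsIndexCode E (id : (V → A) → (V → A)) fun j _ w => w j :=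
  ⟨fun _ _ _ _ _ => rfl, fun _ _ => rfl⟩

/-- The partitions of `V → Fin s` given by the coordinates and by the message `Φ`. -/
def codePartition {V W : Type*} {s : ℕ} (Φ : (V → Fin s) → W) : Option V → Setoid (V → Fin s)
  | none => Setoid.ker Φ
  | some j => Setoid.ker fun x => x j

lemma rel_inf_image_some {V W : Type*} [DecidableEq V] {s : ℕ} (Φ : (V → Fin s) → W) (S : Finset V)
    (x y : V → Fin s) :
    ((S.image some).inf (codePartition Φ)) x y ↔ ∀ i ∈ S, x i = y i := by
  induction S using Finset.induction_on with
  | empty => exact ⟨fun _ i hi => absurd hi (Finset.notMem_empty i), fun _ => trivial⟩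
  | insert a S _ ih =>
    rw [Finset.image_insert, Finset.inf_insert, Finset.forall_mem_insert, ← ih]
    exact Iff.rfl

variable {V : Type*} [Fintype V]

/-- The uniform distribution on `V → Fin s`. -/
noncomputable def unifWeight (V : Type*) [Fintype V] (s : ℕ) (_ : V → Fin s) : ℝ :=
  ((s : ℝ) ^ Fintype.card V)⁻¹

lemma unifWeight_nonneg (s : ℕ) (x : V → Fin s) : 0 ≤ unifWeight V s x := by
  unfold unifWeight
  positivity

variable [DecidableEq V]

lemma sum_unifWeight {s : ℕ} (hs : 2 ≤ s) : ∑ x, unifWeight V s x = 1 := by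
  have : (s : ℝ) ≠ 0 := by positivity
  simp [unifWeight, this]

lemma protocolEntropy_eq {W : Type*} [Fintype W] [DecidableEq W] (s : ℕ)
    (Φ : (V → Fin s) → W) :
    protocolEntropy s Φ = partEntropy (unifWeight V s) (Setoid.ker Φ) / Real.log s := by
  rw [partEntropy_ker _ _ Finset.univ fun _ => Finset.mem_univ _, protocolEntropy]
  congr 1
  refine Finset.sum_congr rfl fun w _ => ?_
  simp only [unifWeight, Finset.sum_const, nsmul_eq_mul, div_eq_mul_inv]
  congr!

lemma log_natCast_pos {s : ℕ} (hs : 2 ≤ s) : 0 < Real.log s :=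
  Real.log_pos (by exact_mod_cast hs)

lemma protocolEntropy_nonneg {W : Type*} [Fintype W] [DecidableEq W] {s : ℕ} (hs : 2 ≤ s)
    (Φ : (V → Fin s) → W) : 0 ≤ protocolEntropy s Φ := by
  rw [protocolEntropy_eq]
  refine div_nonneg ?_ (log_natCast_pos hs).le
  rw [← partEntropy_top (sum_unifWeight (V := V) hs)]
  exact partEntropy_anti (unifWeight_nonneg s) le_top

lemma protocolEntropy_le_protocolLength {W : Type*} [Fintype W] [DecidableEq W] {s : ℕ}
    (hs : 2 ≤ s) (Φ : (V → Fin s) → W) : protocolEntropy s Φ ≤ protocolLength s Φ := by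
  rw [protocolEntropy_eq, protocolLength, Real.logb]
  exact div_le_div_of_nonneg_right (partEntropy_ker_le (unifWeight_nonneg s) (sum_unifWeight hs) Φ _
    fun x => Finset.mem_image_of_mem _ (Finset.mem_univ x)) (log_natCast_pos hs).le

lemma partEntropy_unifWeight_bot (s : ℕ) (hs : 2 ≤ s) :
    partEntropy (unifWeight V s) ⊥ = Fintype.card V * Real.log s := by
  classical
  have h : ∀ x, classWeight (unifWeight V s) ⊥ x = ((s : ℝ) ^ Fintype.card V)⁻¹ := fun x => by
    simp [classWeight, unifWeight]
  simp only [partEntropy, h]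
  rw [← Finset.sum_mul, sum_unifWeight hs, Real.log_inv, Real.log_pow]
  ring

lemma inf_univ_codePartition {W : Type*} {s : ℕ} (Φ : (V → Fin s) → W) :
    ((Finset.univ : Finset V).image some).inf (codePartition Φ) = ⊥ :=
  Setoid.ext fun x y => by simp [rel_inf_image_some, funext_iff]

lemma wConstraints_partEntropy {W : Type*} (E : V → V → Prop) [DecidableRel E] {s : ℕ}
    (hs : 2 ≤ s) {Φ : (V → Fin s) → W} {d : V → (V → Fin s) → W → Fin s}
    (hd : IsIndexCode E Φ d) :
    WConstraints E fun S => partEntropy (unifWeight V s) (S.inf (codePartition Φ)) / Real.log s := by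
  refine ⟨fun j => ?_, ?_, ?_⟩
  · simp only
    rw [Finset.inf_insert, inf_eq_right.2]
    intro x y hxy
    rw [Finset.inf_insert] at hxy
    have hΦ : Φ x = Φ y := hxy.1
    have hN := (rel_inf_image_some Φ _ x y).1 hxy.2
    change x j = y j
    rw [← hd.2 x j, ← hd.2 y j, hΦ]
    exact hd.1 j x y _ fun i hi => hN i (by simp [inNbr, hi])
  · simp only [Finset.inf_insert, inf_univ_codePartition, inf_bot_eq]
  · simp only [inf_univ_codePartition, partEntropy_unifWeight_bot s hs]
    exact mul_div_cancel_right₀ _ (log_natCast_pos hs).ne'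

lemma exists_zyEntLike_of_indexCode {W : Type*} [Fintype W] [DecidableEq W]
    (E : V → V → Prop) [DecidableRel E] {s : ℕ} (hs : 2 ≤ s) {Φ : (V → Fin s) → W}
    {d : V → (V → Fin s) → W → Fin s} (hd : IsIndexCode E Φ d) :
    ∃ f : Finset (Option V) → ℝ, ZYEntLike f ∧ (∀ j : V, f {some j} ≤ 1) ∧ WConstraints E f ∧
      protocolEntropy s Φ = f {none} := by
  have hl := log_natCast_pos hs
  refine ⟨fun S => partEntropy (unifWeight V s) (S.inf (codePartition Φ)) / Real.log s,
    zyEntLike_partEntropy (unifWeight_nonneg s) (sum_unifWeight hs) _ hl.le, fun j => ?_,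
    wConstraints_partEntropy E hs hd, ?_⟩
  · simp only [Finset.inf_singleton, codePartition]
    rw [div_le_one hl]
    simpa using partEntropy_ker_le (unifWeight_nonneg s) (sum_unifWeight hs)
      (fun x : V → Fin s => x j) Finset.univ fun _ => Finset.mem_univ _
  · simp only [Finset.inf_singleton, codePartition, protocolEntropy_eq]

lemma SEntLike.nonneg {U : Type*} [DecidableEq U] {f : Finset U → ℝ} (hf : SEntLike f)
    (X : Finset U) : 0 ≤ f X :=
  hf.1 ▸ hf.2.1 ∅ X (Finset.empty_subset X)

end IndexCode

/-- `i(G,s) ≥ i_entro(G,s) ≥ i_ZY(G) ≥ i_S(G)`. -/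
theorem indexCode_chain {V : Type} [Fintype V] [DecidableEq V]
    (E : V → V → Prop) [DecidableRel E] (s : ℕ) (hs : 2 ≤ s) :
    indexCodeEntro E s ≤ indexCodeLen E s
    ∧ iZY E ≤ indexCodeEntro E s
    ∧ iS E ≤ iZY E := by
  have hid := isIndexCode_id (A := Fin s) E
  unfold indexCodeLen indexCodeEntro iZY iS
  refine ⟨?_, ?_, ?_⟩
  · refine le_csInf ⟨_, _, inferInstance, inferInstance, id, _, hid, rfl⟩ ?_
    rintro _ ⟨W, iW, dW, Φ, d, hd, rfl⟩
    refine le_trans (csInf_le ⟨0, ?_⟩ ⟨W, iW, dW, Φ, d, hd, rfl⟩)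
      (protocolEntropy_le_protocolLength hs Φ)
    rintro _ ⟨W, iW, dW, Φ, d, -, rfl⟩
    exact protocolEntropy_nonneg hs Φ
  · refine le_csInf ⟨_, _, inferInstance, inferInstance, id, _, hid, rfl⟩ ?_
    rintro _ ⟨W, iW, dW, Φ, d, hd, rfl⟩
    refine csInf_le ⟨0, ?_⟩ (exists_zyEntLike_of_indexCode E hs hd)
    rintro _ ⟨f, hf, -, -, rfl⟩
    exact hf.1.nonneg _
  · refine csInf_le_csInf ⟨0, ?_⟩ ⟨_, exists_zyEntLike_of_indexCode E hs hid⟩ ?_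
    · rintro _ ⟨f, hf, -, -, rfl⟩
      exact hf.nonneg _
    · rintro _ ⟨f, hf, h1, hw, rfl⟩
      exact ⟨f, hf.1, h1, hw, rfl⟩
end

section
/- There exists a finite directed graph G whose ZY-entropy is strictly smaller than its S-entropy: E_ZY(G) < E_S(G). Consequently, since E(G) ≤ E_ZY(G), the general entropy of G cannot be determined using only Shannon's classical information inequalities, and the Zhang–Yeung non-Shannon information inequality yields a strictly better upper bound on E(G). -/
open Finset

theorem restrict_eq_iff {Ω U A : Type*} {X : U → Ω → A} {S : Finset U} {ω ω' : Ω} :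
    ((fun i : S => X i ω') = fun i : S => X i ω) ↔ ∀ i ∈ S, X i ω' = X i ω := by
  simp [funext_iff]

section Entropy

variable {Ω β γ δ ε : Type*} [Fintype Ω]

open Classical in
/-- The probability, under the weights `p`, of the fibre of `X` through `ω`. -/
noncomputable def fiberProb (p : Ω → ℝ) (X : Ω → β) (ω : Ω) : ℝ :=
  ∑ ω', if X ω' = X ω then p ω' else 0

/-- The Shannon entropy (in nats) of the random variable `X` under the weights `p`. -/
noncomputable def entropy (p : Ω → ℝ) (X : Ω → β) : ℝ :=
  -∑ ω, p ω * Real.log (fiberProb p X ω)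

theorem entropy_eq_sum_negMulLog [Fintype β] [DecidableEq β] (p : Ω → ℝ) (X : Ω → β) :
    entropy p X = ∑ b, Real.negMulLog (∑ ω, if X ω = b then p ω else 0) := by
  have h : ∀ b, Real.negMulLog (∑ ω, if X ω = b then p ω else 0) =
      ∑ ω, if X ω = b then -(p ω * Real.log (fiberProb p X ω)) else 0 := by
    intro b
    rw [Real.negMulLog, neg_mul, Finset.sum_mul, ← Finset.sum_neg_distrib]
    refine Finset.sum_congr rfl fun ω _ => ?_
    split_ifs with hb
    · subst hb
      unfold fiberProb
      congr!
    · simp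
  simp_rw [h]
  rw [Finset.sum_comm]
  simp [entropy]

theorem fiberProb_congr {p : Ω → ℝ} {X : Ω → β} {Y : Ω → γ}
    (h : ∀ ω ω', p ω ≠ 0 → p ω' ≠ 0 → (X ω' = X ω ↔ Y ω' = Y ω)) {ω : Ω} (hω : p ω ≠ 0) :
    fiberProb p X ω = fiberProb p Y ω := by
  classical
  refine Finset.sum_congr rfl fun ω' _ => ?_
  by_cases h0 : p ω' = 0
  · simp [h0]
  · exact if_congr (h ω ω' hω h0) rfl rfl

theorem entropy_congr {p : Ω → ℝ} {X : Ω → β} {Y : Ω → γ}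
    (h : ∀ ω ω', p ω ≠ 0 → p ω' ≠ 0 → (X ω' = X ω ↔ Y ω' = Y ω)) :
    entropy p X = entropy p Y := by
  unfold entropy
  congr 1
  refine Finset.sum_congr rfl fun ω _ => ?_
  by_cases h0 : p ω = 0
  · simp [h0]
  · rw [fiberProb_congr h h0]

theorem fiberProb_nonneg {p : Ω → ℝ} (hp : ∀ ω, 0 ≤ p ω) (X : Ω → β) (ω : Ω) :
    0 ≤ fiberProb p X ω :=
  Finset.sum_nonneg fun ω' _ => by split_ifs <;> simp [hp]

theorem le_fiberProb {p : Ω → ℝ} (hp : ∀ ω, 0 ≤ p ω) (X : Ω → β) (ω : Ω) :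
    p ω ≤ fiberProb p X ω := by
  classical
  refine le_trans (by simp) (Finset.single_le_sum (f := fun ω' => if X ω' = X ω then p ω' else 0)
    (fun ω' _ => by split_ifs <;> simp [hp]) (Finset.mem_univ ω))

theorem fiberProb_of_eq (p : Ω → ℝ) {X : Ω → β} {ω ω' : Ω} (h : X ω = X ω') :
    fiberProb p X ω = fiberProb p X ω' := by
  unfold fiberProb
  rw [h]

theorem fiberProb_anti {p : Ω → ℝ} (hp : ∀ ω, 0 ≤ p ω) {X : Ω → β} {Y : Ω → γ} {ω : Ω}
    (h : ∀ ω', Y ω' = Y ω → X ω' = X ω) : fiberProb p Y ω ≤ fiberProb p X ω := by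
  refine Finset.sum_le_sum fun ω' _ => ?_
  by_cases hY : Y ω' = Y ω
  · simp [hY, h ω' hY]
  · rw [if_neg hY]
    split_ifs <;> simp [hp]

theorem entropy_mono {p : Ω → ℝ} (hp : ∀ ω, 0 ≤ p ω) {X : Ω → β} {Y : Ω → γ}
    (h : ∀ ω ω', Y ω' = Y ω → X ω' = X ω) : entropy p X ≤ entropy p Y := by
  refine neg_le_neg (Finset.sum_le_sum fun ω _ => ?_)
  rcases (hp ω).eq_or_lt with h0 | h0
  · simp [← h0]
  · exact mul_le_mul_of_nonneg_left (Real.log_le_log (h0.trans_le (le_fiberProb hp Y ω))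
      (fiberProb_anti hp (h ω))) h0.le

theorem entropy_eq_zero_of_const {p : Ω → ℝ} (hp : ∑ ω, p ω = 1) {X : Ω → β}
    (h : ∀ ω ω', X ω' = X ω) : entropy p X = 0 := by
  have : ∀ ω, fiberProb p X ω = 1 := fun ω => by simp [fiberProb, h ω, hp]
  simp [entropy, this]

open Classical in
theorem sum_fiberProb_ratio_le_one {p : Ω → ℝ} (hp : ∀ ω, 0 ≤ p ω) (hp1 : ∑ ω, p ω = 1)
    {W : Ω → β} {X : Ω → γ} {Y : Ω → δ} {Z : Ω → ε}
    (hW : ∀ ω ω', W ω' = W ω ↔ X ω' = X ω ∧ Y ω' = Y ω)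
    (hX : ∀ ω ω', X ω' = X ω → Z ω' = Z ω) (hY : ∀ ω ω', Y ω' = Y ω → Z ω' = Z ω) :
    ∑ ω, p ω * (fiberProb p X ω * fiberProb p Y ω / (fiberProb p W ω * fiberProb p Z ω)) ≤ 1 := by
  have hexp : ∀ ω, p ω * (fiberProb p X ω * fiberProb p Y ω /
      (fiberProb p W ω * fiberProb p Z ω)) = ∑ ω₁, ∑ ω₂,
        if X ω₁ = X ω ∧ Y ω₂ = Y ω then
          p ω₁ * p ω₂ / fiberProb p Z ω₁ * (p ω / fiberProb p W ω) else 0 := by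
    intro ω
    have h1 : p ω * (fiberProb p X ω * fiberProb p Y ω /
        (fiberProb p W ω * fiberProb p Z ω)) = fiberProb p X ω * fiberProb p Y ω *
          (p ω / (fiberProb p W ω * fiberProb p Z ω)) := by ring
    rw [h1]
    conv_lhs => rw [fiberProb, fiberProb, Finset.sum_mul_sum, Finset.sum_mul]
    refine Finset.sum_congr rfl fun ω₁ _ => ?_
    rw [Finset.sum_mul]
    refine Finset.sum_congr rfl fun ω₂ _ => ?_
    by_cases hx : X ω₁ = X ω
    · by_cases hy : Y ω₂ = Y ω
      · rw [if_pos hx, if_pos hy, if_pos ⟨hx, hy⟩, fiberProb_of_eq p (hX _ _ hx)]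
        field_simp
      · simp [hy]
    · simp [hx]
  have hinner : ∀ ω₁ ω₂, (∑ ω, if X ω₁ = X ω ∧ Y ω₂ = Y ω then
      p ω₁ * p ω₂ / fiberProb p Z ω₁ * (p ω / fiberProb p W ω) else 0) ≤
      if Z ω₂ = Z ω₁ then p ω₁ * p ω₂ / fiberProb p Z ω₁ else 0 := by
    intro ω₁ ω₂
    have hc : 0 ≤ p ω₁ * p ω₂ / fiberProb p Z ω₁ :=
      div_nonneg (mul_nonneg (hp _) (hp _)) (fiberProb_nonneg hp _ _)
    by_cases hex : ∃ ω₀, X ω₁ = X ω₀ ∧ Y ω₂ = Y ω₀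
    · obtain ⟨ω₀, hx, hy⟩ := hex
      rw [if_pos ((hY _ _ hy).trans (hX _ _ hx).symm)]
      have hsum : (∑ ω, if X ω₁ = X ω ∧ Y ω₂ = Y ω then
          p ω₁ * p ω₂ / fiberProb p Z ω₁ * (p ω / fiberProb p W ω) else 0) =
          p ω₁ * p ω₂ / fiberProb p Z ω₁ * (fiberProb p W ω₀ / fiberProb p W ω₀) := by
        conv_rhs => rw [fiberProb.eq_1 p W ω₀, Finset.sum_div, Finset.mul_sum]
        refine Finset.sum_congr rfl fun ω _ => ?_
        have hiff : (X ω₁ = X ω ∧ Y ω₂ = Y ω) ↔ W ω = W ω₀ := by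
          rw [hW, hx, hy, eq_comm, @eq_comm _ (Y ω₀)]
        simp only [hiff]
        split_ifs with h
        · rw [fiberProb_of_eq p h, fiberProb.eq_1 p W ω₀]
        · simp
      rw [hsum]
      exact mul_le_of_le_one_right hc (div_self_le_one _)
    · push Not at hex
      rw [Finset.sum_eq_zero fun ω _ => if_neg fun h => hex ω h.1 h.2]
      split_ifs <;> simp [hc]
  simp_rw [hexp]
  rw [Finset.sum_comm]
  refine le_trans (Finset.sum_le_sum fun ω₁ _ => (Finset.sum_comm.trans_le
    (Finset.sum_le_sum fun ω₂ _ => hinner ω₁ ω₂))) ?_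
  rw [← hp1]
  refine Finset.sum_le_sum fun ω₁ _ => ?_
  have : (∑ ω₂, if Z ω₂ = Z ω₁ then p ω₁ * p ω₂ / fiberProb p Z ω₁ else 0) =
      p ω₁ * (fiberProb p Z ω₁ / fiberProb p Z ω₁) := by
    conv_rhs => rw [fiberProb.eq_1 p Z ω₁, Finset.sum_div, Finset.mul_sum]
    refine Finset.sum_congr rfl fun ω₂ _ => ?_
    split_ifs
    · rw [fiberProb]; ring
    · simp
  rw [this]
  exact mul_le_of_le_one_right (hp _) (div_self_le_one _)

/-- Submodularity of entropy: `W` is the join of `X` and `Y`, and `Z` is a function of each. -/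
theorem entropy_submodular {p : Ω → ℝ} (hp : ∀ ω, 0 ≤ p ω) (hp1 : ∑ ω, p ω = 1)
    {W : Ω → β} {X : Ω → γ} {Y : Ω → δ} {Z : Ω → ε}
    (hW : ∀ ω ω', W ω' = W ω ↔ X ω' = X ω ∧ Y ω' = Y ω)
    (hX : ∀ ω ω', X ω' = X ω → Z ω' = Z ω) (hY : ∀ ω ω', Y ω' = Y ω → Z ω' = Z ω) :
    entropy p Z + entropy p W ≤ entropy p X + entropy p Y := by
  have hterm : ∀ ω, p ω * (Real.log (fiberProb p X ω) + Real.log (fiberProb p Y ω) -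
      Real.log (fiberProb p W ω) - Real.log (fiberProb p Z ω)) ≤
      p ω * (fiberProb p X ω * fiberProb p Y ω / (fiberProb p W ω * fiberProb p Z ω)) - p ω := by
    intro ω
    rcases (hp ω).eq_or_lt with h0 | h0
    · simp [← h0]
    · have hX0 := h0.trans_le (le_fiberProb hp X ω)
      have hY0 := h0.trans_le (le_fiberProb hp Y ω)
      have hW0 := h0.trans_le (le_fiberProb hp W ω)
      have hZ0 := h0.trans_le (le_fiberProb hp Z ω)
      have h := Real.log_le_sub_one_of_pos (div_pos (mul_pos hX0 hY0) (mul_pos hW0 hZ0))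
      rw [Real.log_div (by positivity) (by positivity), Real.log_mul hX0.ne' hY0.ne',
        Real.log_mul hW0.ne' hZ0.ne'] at h
      have := mul_le_mul_of_nonneg_left h h0.le
      linarith
  have hsum := Finset.sum_le_sum fun ω (_ : ω ∈ Finset.univ) => hterm ω
  rw [Finset.sum_sub_distrib, hp1] at hsum
  have hratio := sum_fiberProb_ratio_le_one hp hp1 hW hX hY
  simp only [mul_sub, mul_add, Finset.sum_sub_distrib, Finset.sum_add_distrib] at hsum
  unfold entropy
  linarith

/-- Entropy of the subfamilies of a family of random variables. -/
noncomputable def jointEntropy {U A : Type*} (p : Ω → ℝ) (X : U → Ω → A) (S : Finset U) : ℝ :=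
  entropy p fun ω (i : S) => X i ω

theorem sEntLike_jointEntropy {U A : Type*} [DecidableEq U] {p : Ω → ℝ} (hp : ∀ ω, 0 ≤ p ω)
    (hp1 : ∑ ω, p ω = 1) (X : U → Ω → A) : SEntLike (jointEntropy p X) := by
  refine ⟨entropy_eq_zero_of_const hp1 fun _ _ => Subsingleton.elim _ _,
    fun S T hST => entropy_mono hp fun ω ω' => ?_, fun S T => entropy_submodular hp hp1
      (fun ω ω' => ?_) (fun ω ω' => ?_) (fun ω ω' => ?_)⟩
  all_goals simp only [restrict_eq_iff, Finset.mem_union, Finset.mem_inter]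
  · exact fun h i hi => h i (hST hi)
  · exact ⟨fun h => ⟨fun i hi => h i (.inl hi), fun i hi => h i (.inr hi)⟩,
      fun h i hi => hi.elim (h.1 i) (h.2 i)⟩
  · exact fun h i hi => h i hi.1
  · exact fun h i hi => h i hi.2

end Entropy

section Copy

variable {Ω β γ : Type*} [Fintype Ω]

open Classical in
/-- The law of a pair of samples of `p` that agree on `Z` and are conditionally independent
given `Z`. -/
noncomputable def copyDist (p : Ω → ℝ) (Z : Ω → β) (w : Ω × Ω) : ℝ :=
  if Z w.2 = Z w.1 then p w.1 * p w.2 / fiberProb p Z w.1 else 0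

theorem copyDist_nonneg {p : Ω → ℝ} (hp : ∀ ω, 0 ≤ p ω) (Z : Ω → β) (w : Ω × Ω) :
    0 ≤ copyDist p Z w := by
  unfold copyDist
  split_ifs
  · exact div_nonneg (mul_nonneg (hp _) (hp _)) (fiberProb_nonneg hp _ _)
  · exact le_rfl

theorem copyDist_swap (p : Ω → ℝ) (Z : Ω → β) (ω ω' : Ω) :
    copyDist p Z (ω, ω') = copyDist p Z (ω', ω) := by
  unfold copyDist
  by_cases h : Z ω = Z ω'
  · simp only [h, if_true, fiberProb_of_eq p h, mul_comm]
  · simp [h, Ne.symm h]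

theorem sum_copyDist_right {p : Ω → ℝ} (hp : ∀ ω, 0 ≤ p ω) (Z : Ω → β) (ω : Ω) :
    ∑ ω', copyDist p Z (ω, ω') = p ω := by
  have h : ∑ ω', copyDist p Z (ω, ω') = p ω * (fiberProb p Z ω / fiberProb p Z ω) := by
    conv_rhs => rw [fiberProb.eq_1 p Z ω, Finset.sum_div, Finset.mul_sum]
    refine Finset.sum_congr rfl fun ω' _ => ?_
    simp only [copyDist]
    split_ifs
    · rw [fiberProb]; ring
    · simp
  rw [h]
  rcases (hp ω).eq_or_lt with h0 | h0
  · simp [← h0]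
  · rw [div_self (h0.trans_le (le_fiberProb hp Z ω)).ne', mul_one]

theorem sum_copyDist_mul_fst {p : Ω → ℝ} (hp : ∀ ω, 0 ≤ p ω) (Z : Ω → β) (g : Ω → ℝ) :
    ∑ w, copyDist p Z w * g w.1 = ∑ ω, p ω * g ω := by
  rw [Fintype.sum_prod_type]
  refine Finset.sum_congr rfl fun ω _ => ?_
  simp only [← Finset.sum_mul, sum_copyDist_right hp]

theorem sum_copyDist_mul_snd {p : Ω → ℝ} (hp : ∀ ω, 0 ≤ p ω) (Z : Ω → β) (g : Ω → ℝ) :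
    ∑ w, copyDist p Z w * g w.2 = ∑ ω, p ω * g ω := by
  rw [← sum_copyDist_mul_fst hp Z, ← Equiv.sum_comp (Equiv.prodComm Ω Ω)]
  exact Finset.sum_congr rfl fun w _ => by
    rw [show (Equiv.prodComm Ω Ω) w = (w.2, w.1) from rfl, copyDist_swap]

theorem sum_copyDist {p : Ω → ℝ} (hp : ∀ ω, 0 ≤ p ω) (Z : Ω → β) :
    ∑ w, copyDist p Z w = ∑ ω, p ω := by
  simpa using sum_copyDist_mul_fst hp Z fun _ => 1

theorem fiberProb_copyDist_fst {p : Ω → ℝ} (hp : ∀ ω, 0 ≤ p ω) (Z : Ω → β) (X : Ω → γ)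
    (w : Ω × Ω) : fiberProb (copyDist p Z) (fun w => X w.1) w = fiberProb p X w.1 := by
  classical
  have h := sum_copyDist_mul_fst hp Z fun ω => if X ω = X w.1 then (1 : ℝ) else 0
  simpa [fiberProb] using h

theorem fiberProb_copyDist_snd {p : Ω → ℝ} (hp : ∀ ω, 0 ≤ p ω) (Z : Ω → β) (X : Ω → γ)
    (w : Ω × Ω) : fiberProb (copyDist p Z) (fun w => X w.2) w = fiberProb p X w.2 := by
  classical
  have h := sum_copyDist_mul_snd hp Z fun ω => if X ω = X w.2 then (1 : ℝ) else 0
  simpa [fiberProb] using h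

theorem entropy_copyDist_fst {p : Ω → ℝ} (hp : ∀ ω, 0 ≤ p ω) (Z : Ω → β) (X : Ω → γ) :
    entropy (copyDist p Z) (fun w => X w.1) = entropy p X := by
  simp only [entropy, fiberProb_copyDist_fst hp]
  rw [sum_copyDist_mul_fst hp Z fun ω => Real.log (fiberProb p X ω)]

theorem entropy_copyDist_snd {p : Ω → ℝ} (hp : ∀ ω, 0 ≤ p ω) (Z : Ω → β) (X : Ω → γ) :
    entropy (copyDist p Z) (fun w => X w.2) = entropy p X := by
  simp only [entropy, fiberProb_copyDist_snd hp]
  rw [sum_copyDist_mul_snd hp Z fun ω => Real.log (fiberProb p X ω)]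

theorem copyDist_ne_zero {p : Ω → ℝ} {Z : Ω → β} {w : Ω × Ω} (h : copyDist p Z w ≠ 0) :
    Z w.2 = Z w.1 ∧ p w.1 ≠ 0 ∧ p w.2 ≠ 0 := by
  unfold copyDist at h
  split_ifs at h with hZ
  · refine ⟨hZ, ?_, ?_⟩ <;> intro h0 <;> simp [h0] at h
  · exact absurd rfl h

theorem fiberProb_id (p : Ω → ℝ) (ω : Ω) : fiberProb p id ω = p ω := by
  rw [fiberProb, Finset.sum_eq_single ω] <;> simp +contextual

theorem entropy_copyDist_id {p : Ω → ℝ} (hp : ∀ ω, 0 ≤ p ω) (Z : Ω → β) :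
    entropy (copyDist p Z) id = 2 * entropy p id - entropy p Z := by
  have hterm : ∀ w, copyDist p Z w * Real.log (fiberProb (copyDist p Z) id w) =
      copyDist p Z w * Real.log (p w.1) + copyDist p Z w * Real.log (p w.2) -
        copyDist p Z w * Real.log (fiberProb p Z w.1) := by
    intro w
    rw [fiberProb_id]
    by_cases h : copyDist p Z w = 0
    · simp [h]
    · obtain ⟨hZ, h1, h2⟩ := copyDist_ne_zero h
      have h3 := (((hp _).lt_of_ne' h1).trans_le (le_fiberProb hp Z w.1)).ne'
      have hlog : Real.log (copyDist p Z w) =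
          Real.log (p w.1) + Real.log (p w.2) - Real.log (fiberProb p Z w.1) := by
        rw [copyDist, if_pos hZ, Real.log_div (mul_ne_zero h1 h2) h3, Real.log_mul h1 h2]
      rw [hlog]
      ring
  simp only [entropy, hterm, Finset.sum_sub_distrib, Finset.sum_add_distrib]
  rw [sum_copyDist_mul_fst hp Z fun ω => Real.log (p ω),
    sum_copyDist_mul_snd hp Z fun ω => Real.log (p ω),
    sum_copyDist_mul_fst hp Z fun ω => Real.log (fiberProb p Z ω)]
  simp only [fiberProb_id]
  ring

end Copy

section ZhangYeung

/-- The submodular inequality in conditional form. -/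
theorem SEntLike.cond {U : Type*} [DecidableEq U] {f : Finset U → ℝ} (hf : SEntLike f)
    {X Y Z P Q R : Finset U} (hP : P = X ∪ Z) (hQ : Q = Y ∪ Z) (hR : R = X ∪ Y ∪ Z) :
    f R + f Z ≤ f P + f Q := by
  have h := hf.2.2 P Q
  have h1 : f Z ≤ f (P ∩ Q) := hf.2.1 _ _ (by
    subst hP hQ; exact Finset.subset_inter Finset.subset_union_right Finset.subset_union_right)
  have h2 : P ∪ Q = R := by
    subst hP hQ hR; ext; simp only [Finset.mem_union]; tauto
  rw [h2] at h
  linarith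

/-- The Zhang–Yeung inequality for `A B C D` follows from Shannon's inequalities, given a copy
`A'` of `A` over `C ∪ D`. -/
theorem SEntLike.zhangYeung_of_copy {U : Type*} [DecidableEq U] {f : Finset U → ℝ}
    (hf : SEntLike f) (A B C D A' : Finset U)
    (hA : f A' = f A) (hC : f (C ∪ A') = f (A ∪ C)) (hD : f (D ∪ A') = f (A ∪ D))
    (hCD : f (C ∪ D ∪ A') = f (A ∪ C ∪ D))
    (hind : f (A ∪ B ∪ C ∪ D) + f (C ∪ D ∪ A') ≤ f (A ∪ B ∪ C ∪ D ∪ A') + f (C ∪ D)) :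
    2 * mutI f C D ∅ ≤ mutI f A B ∅ + mutI f A (C ∪ D) ∅ + 3 * mutI f C D A + mutI f C D B := by
  have e1 : C ∪ A = A ∪ C := Finset.union_comm _ _
  have e2 : D ∪ A = A ∪ D := Finset.union_comm _ _
  have e3 : C ∪ B = B ∪ C := Finset.union_comm _ _
  have e4 : D ∪ B = B ∪ D := Finset.union_comm _ _
  have e5 : C ∪ D ∪ A = A ∪ C ∪ D := by ext; simp only [Finset.mem_union]; tauto
  have e6 : C ∪ D ∪ B = B ∪ C ∪ D := by ext; simp only [Finset.mem_union]; tauto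
  have e7 : A ∪ (C ∪ D) = A ∪ C ∪ D := (Finset.union_assoc _ _ _).symm
  simp only [mutI, Finset.union_empty, hf.1, e1, e2, e3, e4, e5, e6, e7]
  have hab_r : f (A ∪ B ∪ A') + f (A') ≤
      f (A ∪ A') + f (B ∪ A') :=
    hf.cond (X := A) (Y := B) (by grind) (by grind) (by grind)
  have hrcd_ab : f (A ∪ B ∪ C ∪ D ∪ A') + f (A ∪ B) ≤
      f (A ∪ B ∪ A') + f (A ∪ B ∪ C ∪ D) :=
    hf.cond (X := A') (Y := C ∪ D) (by grind) (by grind) (by grind)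
  have hra_cd : f (A ∪ C ∪ D ∪ A') + f (C ∪ D) ≤
      f (C ∪ D ∪ A') + f (A ∪ C ∪ D) :=
    hf.cond (X := A') (Y := A) (by grind) (by grind) (by grind)
  have hrb_cd : f (B ∪ C ∪ D ∪ A') + f (C ∪ D) ≤
      f (C ∪ D ∪ A') + f (B ∪ C ∪ D) :=
    hf.cond (X := A') (Y := B) (by grind) (by grind) (by grind)
  have hcd_ar : f (A ∪ C ∪ D ∪ A') + f (A ∪ A') ≤
      f (A ∪ C ∪ A') + f (A ∪ D ∪ A') :=
    hf.cond (X := C) (Y := D) (by grind) (by grind) (by grind)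
  have hcd_br : f (B ∪ C ∪ D ∪ A') + f (B ∪ A') ≤
      f (B ∪ C ∪ A') + f (B ∪ D ∪ A') :=
    hf.cond (X := C) (Y := D) (by grind) (by grind) (by grind)
  have hra_d : f (A ∪ D ∪ A') + f (D) ≤
      f (D ∪ A') + f (A ∪ D) :=
    hf.cond (X := A') (Y := A) (by grind) (by grind) (by grind)
  have hra_c : f (A ∪ C ∪ A') + f (C) ≤
      f (C ∪ A') + f (A ∪ C) :=
    hf.cond (X := A') (Y := A) (by grind) (by grind) (by grind)
  have hrb_d : f (B ∪ D ∪ A') + f (D) ≤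
      f (D ∪ A') + f (B ∪ D) :=
    hf.cond (X := A') (Y := B) (by grind) (by grind) (by grind)
  have hrb_c : f (B ∪ C ∪ A') + f (C) ≤
      f (C ∪ A') + f (B ∪ C) :=
    hf.cond (X := A') (Y := B) (by grind) (by grind) (by grind)
  have hrb_acd : f (A ∪ B ∪ C ∪ D ∪ A') + f (A ∪ C ∪ D) ≤
      f (A ∪ C ∪ D ∪ A') + f (A ∪ B ∪ C ∪ D) :=
    hf.cond (X := A') (Y := B) (by grind) (by grind) (by grind)
  have hra_bcd : f (A ∪ B ∪ C ∪ D ∪ A') + f (B ∪ C ∪ D) ≤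
      f (B ∪ C ∪ D ∪ A') + f (A ∪ B ∪ C ∪ D) :=
    hf.cond (X := A') (Y := A) (by grind) (by grind) (by grind)
  linarith

end ZhangYeung

section CopyFamily

variable {Ω β U A : Type*}

theorem disjSum_union_disjSum {α : Type*} [DecidableEq α] (S S' T T' : Finset α) :
    S.disjSum T ∪ S'.disjSum T' = (S ∪ S').disjSum (T ∪ T') := by
  ext (a | a) <;> simp

/-- A family of random variables together with its copy. -/
def copyFamily (X : U → Ω → A) : U ⊕ U → Ω × Ω → A :=
  Sum.elim (fun i w => X i w.1) fun i w => X i w.2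

theorem copyFamily_restrict_iff {X : U → Ω → A} {S T : Finset U} {w w' : Ω × Ω} :
    ((fun i : S.disjSum T => copyFamily X i w') = fun i : S.disjSum T => copyFamily X i w) ↔
      (∀ i ∈ S, X i w'.1 = X i w.1) ∧ ∀ i ∈ T, X i w'.2 = X i w.2 := by
  rw [restrict_eq_iff]
  simp [Sum.forall, copyFamily]

theorem jointEntropy_copyFamily_fst [Fintype Ω] {p : Ω → ℝ} (hp : ∀ ω, 0 ≤ p ω) (Z : Ω → β)
    (X : U → Ω → A) (S : Finset U) :
    jointEntropy (copyDist p Z) (copyFamily X) (S.disjSum ∅) = jointEntropy p X S := by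
  rw [jointEntropy, jointEntropy, ← entropy_copyDist_fst hp Z]
  refine entropy_congr fun w w' _ _ => ?_
  rw [copyFamily_restrict_iff, restrict_eq_iff]
  simp

theorem jointEntropy_copyFamily_of_subset [Fintype Ω] [DecidableEq U] {p : Ω → ℝ}
    (hp : ∀ ω, 0 ≤ p ω) (X : U → Ω → A)
    {K S T : Finset U} (hS : S ⊆ K) :
    jointEntropy (copyDist p fun ω (i : K) => X i ω) (copyFamily X) (S.disjSum T) =
      jointEntropy p X (T ∪ S) := by
  rw [jointEntropy, jointEntropy, ← entropy_copyDist_snd hp fun ω (i : K) => X i ω]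
  refine entropy_congr fun w w' hw hw' => ?_
  have h1 := restrict_eq_iff.1 (copyDist_ne_zero hw).1
  have h2 := restrict_eq_iff.1 (copyDist_ne_zero hw').1
  rw [copyFamily_restrict_iff, restrict_eq_iff]
  simp only [Finset.mem_union]
  constructor
  · rintro ⟨h, h'⟩ i (hi | hi)
    · exact h' i hi
    · rw [h1 i (hS hi), h2 i (hS hi), h i hi]
  · refine fun h => ⟨fun i hi => ?_, fun i hi => h i (.inl hi)⟩
    rw [← h1 i (hS hi), ← h2 i (hS hi), h i (.inr hi)]

/-- A family of random variables and its copy over `K` are conditionally independent given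
`K`. -/
theorem jointEntropy_copyFamily_indep [Fintype Ω] [DecidableEq U] {p : Ω → ℝ}
    (hp : ∀ ω, 0 ≤ p ω) (hp1 : ∑ ω, p ω = 1) (X : U → Ω → A) {K S : Finset U} (hK : K ⊆ S) (T : Finset U) :
    jointEntropy p X S + jointEntropy p X (T ∪ K) ≤
      jointEntropy (copyDist p fun ω (i : K) => X i ω) (copyFamily X) (S.disjSum T) +
        jointEntropy p X K := by
  set Z : Ω → K → A := fun ω (i : K) => X i ω with hZ
  have hq := copyDist_nonneg hp Z
  have hq1 : ∑ w, copyDist p Z w = 1 := (sum_copyDist hp Z).trans hp1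
  let XS : Ω → S → A := fun ω i => X i ω
  let XT : Ω → ↥(T ∪ K) → A := fun ω i => X i ω
  have h1 := entropy_submodular hq hq1 (W := id) (X := fun w => (w.1, XT w.2)) (Y := fun w => w.2)
    (Z := fun w => XT w.2) (fun w w' => by simp only [id, Prod.ext_iff]; grind)
    (fun w w' h => (Prod.ext_iff.1 h).2) (fun w w' h => congrArg XT h)
  have h2 := entropy_submodular hq hq1 (W := fun w => (w.1, XT w.2)) (X := fun w => w.1)
    (Y := fun w => (XS w.1, XT w.2)) (Z := fun w => XS w.1)
    (fun w w' => by simp only [Prod.ext_iff]; grind)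
    (fun w w' h => congrArg XS h) (fun w w' h => (Prod.ext_iff.1 h).1)
  have h3 : entropy (copyDist p Z) (fun w => (XS w.1, XT w.2)) =
      jointEntropy (copyDist p Z) (copyFamily X) (S.disjSum T) := by
    refine entropy_congr fun w w' hw hw' => ?_
    have h1 := restrict_eq_iff.1 (copyDist_ne_zero hw).1
    have h2 := restrict_eq_iff.1 (copyDist_ne_zero hw').1
    rw [copyFamily_restrict_iff, Prod.ext_iff, restrict_eq_iff, restrict_eq_iff]
    refine and_congr_right fun hS => ⟨fun h i hi => h i (Finset.mem_union_left _ hi),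
      fun h i hi => ?_⟩
    rcases Finset.mem_union.1 hi with hi | hi
    · exact h i hi
    · rw [h1 i hi, h2 i hi, hS i (hK hi)]
  have h4 := entropy_copyDist_fst hp Z id
  have h5 := entropy_copyDist_snd hp Z id
  have h6 := entropy_copyDist_fst hp Z XS
  have h7 := entropy_copyDist_snd hp Z XT
  simp only [id] at h4 h5
  rw [entropy_copyDist_id hp, h5, h7] at h1
  rw [h4, h6, h3] at h2
  change entropy p XS + entropy p XT ≤ _ + entropy p Z
  linarith

end CopyFamily

theorem zyEntLike_jointEntropy {Ω U A : Type*} [Fintype Ω] [DecidableEq U] {p : Ω → ℝ}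
    (hp : ∀ ω, 0 ≤ p ω) (hp1 : ∑ ω, p ω = 1) (X : U → Ω → A) : ZYEntLike (jointEntropy p X) := by
  refine ⟨sEntLike_jointEntropy hp hp1 X, fun A B C D => ?_⟩
  have hq := copyDist_nonneg hp fun ω (i : ↥(C ∪ D)) => X i ω
  have hq1 := (sum_copyDist hp fun ω (i : ↥(C ∪ D)) => X i ω).trans hp1
  have hC : C ⊆ C ∪ D := Finset.subset_union_left
  have hD : D ⊆ C ∪ D := Finset.subset_union_right
  have hK : C ∪ D ⊆ A ∪ B ∪ C ∪ D :=
    Finset.union_subset_union (Finset.subset_union_right) subset_rfl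
  have h := (sEntLike_jointEntropy hq hq1 (copyFamily X)).zhangYeung_of_copy (A.disjSum ∅)
    (B.disjSum ∅) (C.disjSum ∅) (D.disjSum ∅) (Finset.disjSum ∅ A)
  have hbot : (∅ : Finset (U ⊕ U)) = Finset.disjSum ∅ ∅ := rfl
  simp only [mutI, hbot, disjSum_union_disjSum, Finset.union_empty, Finset.empty_union,
    jointEntropy_copyFamily_fst hp] at h
  simp only [mutI, Finset.union_empty]
  have h0 := jointEntropy_copyFamily_of_subset hp X (Finset.empty_subset (C ∪ D)) (T := A)
  rw [Finset.union_empty] at h0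
  refine h h0 (jointEntropy_copyFamily_of_subset hp X hC)
    (jointEntropy_copyFamily_of_subset hp X hD) ?_ ?_
  · rw [jointEntropy_copyFamily_of_subset hp X subset_rfl, Finset.union_assoc]
  · rw [jointEntropy_copyFamily_of_subset hp X subset_rfl]
    exact jointEntropy_copyFamily_indep hp hp1 X hK A

theorem entropy_le_log_card {Ω β : Type*} [Fintype Ω] [Fintype β] [Nonempty β] {p : Ω → ℝ}
    (hp : ∀ ω, 0 ≤ p ω) (hp1 : ∑ ω, p ω = 1) (X : Ω → β) :
    entropy p X ≤ Real.log (Fintype.card β) := by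
  classical
  have hn : (0 : ℝ) < Fintype.card β := by exact_mod_cast Fintype.card_pos
  have hterm : ∀ t : ℝ, 0 ≤ t → Real.negMulLog t ≤
      t * Real.log (Fintype.card β) + ((Fintype.card β : ℝ)⁻¹ - t) := by
    intro t ht
    rcases ht.eq_or_lt with rfl | ht
    · simp
    · have h := Real.log_le_sub_one_of_pos (inv_pos.2 (mul_pos ht hn))
      rw [Real.log_inv, Real.log_mul ht.ne' hn.ne'] at h
      have h' := mul_le_mul_of_nonneg_left h ht.le
      have h'' : t * ((t * Fintype.card β)⁻¹ - 1) = (Fintype.card β : ℝ)⁻¹ - t := by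
        field_simp
      rw [h''] at h'
      rw [Real.negMulLog]
      linarith
  have hsum : ∑ b, (∑ ω, if X ω = b then p ω else 0) = 1 := by
    rw [Finset.sum_comm]
    simpa using hp1
  rw [entropy_eq_sum_negMulLog]
  refine (Finset.sum_le_sum fun b _ => hterm _ (Finset.sum_nonneg fun ω _ => ?_)).trans ?_
  · split_ifs <;> simp [hp]
  · rw [Finset.sum_add_distrib, ← Finset.sum_mul, Finset.sum_sub_distrib, hsum]
    simp [hn.ne']

theorem Hent_eq_jointEntropy {V A : Type*} [Fintype V] [DecidableEq V] [Fintype A]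
    [DecidableEq A] (s : ℕ) (p : (V → A) → ℝ) (S : Finset V) :
    Hent s p S = jointEntropy p (fun i x => x i) S / Real.log s := by
  rw [Hent, jointEntropy, entropy_eq_sum_negMulLog]
  simp only [marginalPMF, funext_iff]

theorem ZYEntLike.div_const {U : Type*} [DecidableEq U] {f : Finset U → ℝ} (hf : ZYEntLike f)
    {c : ℝ} (hc : 0 ≤ c) : ZYEntLike fun S => f S / c := by
  refine ⟨⟨by simp [hf.1.1], fun X Y h => div_le_div_of_nonneg_right (hf.1.2.1 X Y h) hc,
    fun X Y => ?_⟩, fun A B C D => ?_⟩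
  · have := div_le_div_of_nonneg_right (hf.1.2.2 X Y) hc
    simpa only [add_div] using this
  · have h : ∀ X Y Z, mutI (fun S => f S / c) X Y Z = mutI f X Y Z / c := fun X Y Z => by
      simp only [mutI]; ring
    have := div_le_div_of_nonneg_right (hf.2 A B C D) hc
    simp only [h]
    linarith [show (2 * mutI f C D ∅) / c = 2 * (mutI f C D ∅ / c) by ring,
      show (mutI f A B ∅ + mutI f A (C ∪ D) ∅ + 3 * mutI f C D A + mutI f C D B) / c =
        mutI f A B ∅ / c + mutI f A (C ∪ D) ∅ / c + 3 * (mutI f C D A / c) + mutI f C D B / c by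
        ring]

theorem zyEntLike_Hent {V A : Type*} [Fintype V] [DecidableEq V] [Fintype A] [DecidableEq A]
    (s : ℕ) {p : (V → A) → ℝ} (hp : IsProbDist p) : ZYEntLike (Hent s p) := by
  rw [show Hent s p = fun S => jointEntropy p (fun i x => x i) S / Real.log s from
    funext (Hent_eq_jointEntropy s p)]
  exact (zyEntLike_jointEntropy hp.1 hp.2 _).div_const (Real.log_natCast_nonneg s)

theorem Hent_singleton_le_one {V : Type*} [Fintype V] [DecidableEq V] {s : ℕ} (hs : 2 ≤ s)
    {p : (V → Fin s) → ℝ} (hp : IsProbDist p) (j : V) : Hent s p {j} ≤ 1 := by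
  have : NeZero s := ⟨by omega⟩
  have hlog : 0 < Real.log s := Real.log_pos (by exact_mod_cast hs)
  rw [Hent_eq_jointEntropy, div_le_one hlog, jointEntropy]
  have h : entropy p (fun x (i : ({j} : Finset V)) => x i) = entropy p fun x => x j :=
    entropy_congr fun x y _ _ => by
      simp [funext_iff]
  rw [h]
  simpa using entropy_le_log_card hp.1 hp.2 fun x => x j

theorem genEntropy_le_ZYEnt {V : Type*} [Fintype V] [DecidableEq V] (E : V → V → Prop)
    [DecidableRel E] (hbdd : BddAbove {h : ℝ | ∃ f : Finset V → ℝ,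
      ZYEntLike f ∧ (∀ j : V, f {j} ≤ 1) ∧ FConstraints E f ∧ h = f Finset.univ}) :
    genEntropy E ≤ ZYEnt E := by
  have h0 : 0 ≤ ZYEnt E := le_csSup hbdd ⟨fun _ => 0,
    ⟨⟨rfl, fun _ _ _ => le_rfl, fun _ _ => by simp⟩, fun _ _ _ _ => by simp [mutI]⟩,
    fun _ => zero_le_one, fun _ => rfl, rfl⟩
  refine Real.sSup_le ?_ h0
  rintro _ ⟨s, hs, rfl⟩
  refine Real.sSup_le ?_ h0
  rintro _ ⟨p, hp, hE, rfl⟩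
  exact le_csSup hbdd ⟨Hent s p, zyEntLike_Hent s hp, Hent_singleton_le_one hs hp,
    fun j => sub_eq_zero.1 (hE j), rfl⟩

section VamosGraph

/-- The in-neighbourhoods of a graph built on the Vámos matroid: `{0, 1}`, `{2, 3}`, `{4, 5}` and
`{6, 7}` are its pairs, and the vertices `8` and `9` let `6` be a function both of `{4, 5, 7}` and
of `{2, 3, 7}`. -/
def vamosNbr : Fin 10 → Finset (Fin 10) :=
  ![{1, 6, 7}, {2, 3, 4, 5, 6, 7}, {3, 4, 5}, {0, 1, 4, 5, 6, 7}, {0, 1, 5}, {0, 1, 2, 3},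
    {8, 9}, {0, 1, 2, 3}, {2, 3, 7, 9}, {4, 5, 7, 8}]

/-- The edge relation with in-neighbourhoods `vamosNbr`. -/
def vamosGraph (i j : Fin 10) : Prop := i ∈ vamosNbr j

instance : DecidableRel vamosGraph := fun i j => by unfold vamosGraph; infer_instance

theorem inNbr_vamosGraph (j : Fin 10) : inNbr vamosGraph j = vamosNbr j := by
  ext
  rw [inNbr, Finset.mem_filter_univ, vamosGraph]

theorem SEntLike.insert_of_inNbr_subset {V : Type*} [Fintype V] [DecidableEq V]
    {E : V → V → Prop} [DecidableRel E] {f : Finset V → ℝ} (hf : SEntLike f)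
    (hE : FConstraints E f) {j : V} {X : Finset V} (h : inNbr E j ⊆ X) :
    f (insert j X) = f X := by
  refine le_antisymm ?_ (hf.2.1 _ _ (Finset.subset_insert _ _))
  have h1 := hf.2.2 X (insert j (inNbr E j))
  have h2 : f (inNbr E j) ≤ f (X ∩ insert j (inNbr E j)) :=
    hf.2.1 _ _ (Finset.subset_inter h (Finset.subset_insert _ _))
  rw [Finset.union_insert, Finset.union_eq_left.2 h, hE j] at h1
  linarith

/-- Adjoining to `X`, one after the other, the vertices of a list, each of which has all its
in-neighbours present already. -/
def vamosDerivable : Finset (Fin 10) → List (Fin 10) → Bool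
  | _, [] => true
  | X, j :: l => decide (vamosNbr j ⊆ X) && vamosDerivable (insert j X) l

theorem eq_of_vamosDerivable {f : Finset (Fin 10) → ℝ} (hf : SEntLike f)
    (hE : FConstraints vamosGraph f) {X : Finset (Fin 10)} {l : List (Fin 10)}
    (h : vamosDerivable X l) : f (X ∪ l.toFinset) = f X := by
  induction l generalizing X with
  | nil => simp
  | cons j l ih =>
    simp only [vamosDerivable, Bool.and_eq_true, decide_eq_true_eq] at h
    rw [← hf.insert_of_inNbr_subset hE ((inNbr_vamosGraph j).trans_subset h.1), ← ih h.2]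
    congr 1
    ext
    simp

theorem SEntLike.union_le {U : Type*} [DecidableEq U] {f : Finset U → ℝ} (hf : SEntLike f)
    (X Y : Finset U) : f (X ∪ Y) ≤ f X + f Y := by
  have h := hf.2.2 X Y
  have h0 := hf.2.1 ∅ (X ∩ Y) (Finset.empty_subset _)
  rw [hf.1] at h0
  linarith

theorem SEntLike.le_card {U : Type*} [DecidableEq U] {f : Finset U → ℝ} (hf : SEntLike f)
    (h1 : ∀ j, f {j} ≤ 1) (X : Finset U) : f X ≤ X.card := by
  induction X using Finset.induction_on with
  | empty => simp [hf.1]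
  | insert j X hj ih =>
    have := hf.union_le {j} X
    rw [Finset.card_insert_of_notMem hj, Finset.insert_eq]
    push_cast
    linarith [h1 j]

theorem ZYEntLike.univ_le_of_vamosGraph {f : Finset (Fin 10) → ℝ} (hf : ZYEntLike f)
    (h1 : ∀ j, f {j} ≤ 1) (hE : FConstraints vamosGraph f) : f Finset.univ ≤ 74 / 15 := by
  have hS := hf.1
  have closure : ∀ (X : Finset (Fin 10)) (l : List (Fin 10)) (Y : Finset (Fin 10)),
      vamosDerivable X l → X ∪ l.toFinset = Y → f Y = f X := by
    rintro X l Y h rfl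
    exact eq_of_vamosDerivable hS hE h
  have card : ∀ (X : Finset (Fin 10)) (n : ℕ), X.card = n → f X ≤ n := by
    rintro X n rfl
    exact hS.le_card h1 X
  have union : ∀ X Y Z : Finset (Fin 10), X ∪ Y = Z → f Z ≤ f X + f Y := by
    rintro X Y Z rfl
    exact hS.union_le X Y
  have hy := h1 8
  have hAB : f univ ≤ f {0, 1, 2, 3} + f {8} := by
    rw [closure {0, 1, 2, 3, 8} [5, 7, 4, 9, 6] univ (by decide) (by decide)]
    exact union _ _ _ (by decide)
  have hACD : f univ ≤ f {0, 1, 4, 5, 6, 7} + f {8} := by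
    rw [closure {0, 1, 4, 5, 6, 7, 8} [3, 2, 9] univ (by decide) (by decide)]
    exact union _ _ _ (by decide)
  have hBCD : f univ ≤ f {2, 3, 4, 5, 6, 7} + f {8} := by
    rw [closure {2, 3, 4, 5, 6, 7, 8} [1, 0, 9] univ (by decide) (by decide)]
    exact union _ _ _ (by decide)
  have hA : f univ ≤ f {0, 1} + 3 := by
    rw [closure {0, 1, 2, 3, 8} [5, 7, 4, 9, 6] univ (by decide) (by decide)]
    exact (union {0, 1} {2, 3, 8} _ (by decide)).trans (by gcongr; exact card _ 3 (by decide))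
  have hC : f univ ≤ f {4, 5} + 3 := by
    rw [closure {1, 4, 5, 7, 8} [9, 6, 0, 3, 2] univ (by decide) (by decide)]
    exact (union {4, 5} {1, 7, 8} _ (by decide)).trans (by gcongr; exact card _ 3 (by decide))
  have hD : f univ ≤ f {6, 7} + 3 := by
    rw [closure {1, 5, 6, 7, 8} [0, 4, 3, 2, 9] univ (by decide) (by decide)]
    exact (union {6, 7} {1, 5, 8} _ (by decide)).trans (by gcongr; exact card _ 3 (by decide))
  have hAC : f {0, 1, 4, 5} ≤ 3 := by
    rw [closure {0, 1, 5} [4] _ (by decide) (by decide)]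
    exact card _ 3 (by decide)
  have hAD : f {0, 1, 6, 7} ≤ 3 := by
    rw [closure {1, 6, 7} [0] _ (by decide) (by decide)]
    exact card _ 3 (by decide)
  have hBC : f {2, 3, 4, 5} ≤ 3 := by
    rw [closure {3, 4, 5} [2] _ (by decide) (by decide)]
    exact card _ 3 (by decide)
  have hold : f {0, 1, 2, 3, 4, 5, 6, 7} ≤ 4 := by
    rw [closure {1, 5, 6, 7} [0, 4, 3, 2] _ (by decide) (by decide)]
    exact card _ 4 (by decide)
  have hCD : f {4, 5, 6, 7} + f univ ≤ 8 := by
    have h2 := hS.2.2 {4, 5, 6, 7, 8, 9} {0, 1, 2, 3, 4, 5, 6, 7}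
    rw [show ({4, 5, 6, 7, 8, 9} : Finset (Fin 10)) ∩ {0, 1, 2, 3, 4, 5, 6, 7} = {4, 5, 6, 7} by
        decide,
      show ({4, 5, 6, 7, 8, 9} : Finset (Fin 10)) ∪ {0, 1, 2, 3, 4, 5, 6, 7} = univ by decide,
      closure {4, 5, 7, 8} [9, 6] {4, 5, 6, 7, 8, 9} (by decide) (by decide)] at h2
    have h3 := card {4, 5, 7, 8} 4 (by decide)
    norm_num at h3
    linarith
  have hBD : f {2, 3, 6, 7} + f univ ≤ 8 := by
    have h2 := hS.2.2 {2, 3, 6, 7, 8, 9} {0, 1, 2, 3, 4, 5, 6, 7}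
    rw [show ({2, 3, 6, 7, 8, 9} : Finset (Fin 10)) ∩ {0, 1, 2, 3, 4, 5, 6, 7} = {2, 3, 6, 7} by
        decide,
      show ({2, 3, 6, 7, 8, 9} : Finset (Fin 10)) ∪ {0, 1, 2, 3, 4, 5, 6, 7} = univ by decide,
      closure {2, 3, 7, 9} [8, 6] {2, 3, 6, 7, 8, 9} (by decide) (by decide)] at h2
    have h3 := card {2, 3, 7, 9} 4 (by decide)
    norm_num at h3
    linarith
  have hzy := hf.2 {0, 1} {2, 3} {4, 5} {6, 7}
  simp only [mutI, Finset.union_empty, hS.1,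
    show ({0, 1} : Finset (Fin 10)) ∪ {2, 3} = {0, 1, 2, 3} by decide,
    show ({4, 5} : Finset (Fin 10)) ∪ {6, 7} = {4, 5, 6, 7} by decide,
    show ({0, 1} : Finset (Fin 10)) ∪ {4, 5, 6, 7} = {0, 1, 4, 5, 6, 7} by decide,
    show ({4, 5} : Finset (Fin 10)) ∪ {0, 1} = {0, 1, 4, 5} by decide,
    show ({6, 7} : Finset (Fin 10)) ∪ {0, 1} = {0, 1, 6, 7} by decide,
    show ({4, 5, 6, 7} : Finset (Fin 10)) ∪ {0, 1} = {0, 1, 4, 5, 6, 7} by decide,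
    show ({4, 5} : Finset (Fin 10)) ∪ {2, 3} = {2, 3, 4, 5} by decide,
    show ({6, 7} : Finset (Fin 10)) ∪ {2, 3} = {2, 3, 6, 7} by decide,
    show ({4, 5, 6, 7} : Finset (Fin 10)) ∪ {2, 3} = {2, 3, 4, 5, 6, 7} by decide] at hzy
  linarith

theorem sEntLike_of_local {U : Type*} [DecidableEq U] {f : Finset U → ℝ} (h0 : f ∅ = 0)
    (hmono : ∀ X, ∀ i ∉ X, f X ≤ f (insert i X))
    (hsub : ∀ X, ∀ i ∉ X, ∀ j ∉ X, i ≠ j →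
      f (insert i (insert j X)) + f X ≤ f (insert i X) + f (insert j X)) : SEntLike f := by
  have mono : ∀ X i, f X ≤ f (insert i X) := fun X i => by
    by_cases hi : i ∈ X
    · rw [Finset.insert_eq_of_mem hi]
    · exact hmono X i hi
  have two : ∀ X i j, f (insert i (insert j X)) + f X ≤ f (insert i X) + f (insert j X) := by
    intro X i j
    by_cases hi : i ∈ X
    · rw [Finset.insert_eq_of_mem hi, Finset.insert_eq_of_mem (Finset.mem_insert_of_mem hi),
        add_comm]
    by_cases hj : j ∈ X
    · rw [Finset.insert_eq_of_mem hj]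
    by_cases hij : i = j
    · rw [hij, Finset.insert_idem]
      linarith [mono X j]
    exact hsub X i hi j hj hij
  have one : ∀ X i T, f (insert i (T ∪ X)) + f X ≤ f (insert i X) + f (T ∪ X) := by
    intro X i T
    induction T using Finset.induction_on with
    | empty => rw [Finset.empty_union]
    | insert j T _ ih =>
      rw [Finset.insert_union]
      linarith [two (T ∪ X) i j]
  refine ⟨h0, fun X Y h => ?_, fun X Y => ?_⟩
  · have hT : ∀ T, f X ≤ f (T ∪ X) := fun T => by
      induction T using Finset.induction_on with
      | empty => rw [Finset.empty_union]
      | insert j T _ ih =>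
        rw [Finset.insert_union]
        exact ih.trans (mono _ _)
    simpa [Finset.union_eq_left.2 h] using hT Y
  · have hS : ∀ S, f (S ∪ (Y ∪ X ∩ Y)) + f (X ∩ Y) ≤ f (S ∪ X ∩ Y) + f (Y ∪ X ∩ Y) := fun S => by
      induction S using Finset.induction_on with
      | empty => rw [Finset.empty_union, Finset.empty_union, add_comm]
      | insert i S _ ih =>
        have h := one (S ∪ X ∩ Y) i Y
        rw [Finset.union_left_comm] at h
        rw [Finset.insert_union, Finset.insert_union]
        linarith
    have h := hS X
    rw [Finset.union_eq_left.2 Finset.inter_subset_right,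
      Finset.union_eq_left.2 Finset.inter_subset_left] at h
    linarith

/-- The rank function of the sparse paving matroid of rank `n` with circuit-hyperplanes `C`. -/
def sparsePavingRank {U : Type*} [DecidableEq U] (n : ℕ) (C : Finset (Finset U))
    (X : Finset U) : ℕ :=
  min n X.card - if X ∈ C then 1 else 0

theorem sEntLike_sparsePavingRank {U : Type*} [DecidableEq U] {n : ℕ} {C : Finset (Finset U)}
    (hcard : ∀ A ∈ C, A.card = n) (hC : ∀ A ∈ C, ∀ B ∈ C, A ≠ B → (A ∩ B).card + 2 ≤ n) :
    SEntLike fun X => (sparsePavingRank n C X : ℝ) := by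
  refine sEntLike_of_local (by simp [sparsePavingRank]) (fun X i hi => ?_)
    fun X i hi j hj hij => ?_
  · have h1 := hcard X
    have h2 := hcard (insert i X)
    rw [Finset.card_insert_of_notMem hi] at h2
    rw [Nat.cast_le, sparsePavingRank, sparsePavingRank, Finset.card_insert_of_notMem hi]
    split_ifs <;> grind
  · have hij' : i ∉ insert j X := by simp [hij, hi]
    have h0 := hcard X
    have h1 := hcard (insert i X)
    have h2 := hcard (insert j X)
    have h3 := hcard (insert i (insert j X))
    have h4 : insert i X ∈ C → insert j X ∈ C → X.card + 2 ≤ n := fun hiC hjC =>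
      (Nat.add_le_add_right (Finset.card_le_card (Finset.subset_inter
        (Finset.subset_insert i X) (Finset.subset_insert j X))) 2).trans
        (hC _ hiC _ hjC fun h => hij' (h ▸ Finset.mem_insert_self i X))
    rw [Finset.card_insert_of_notMem hi] at h1
    rw [Finset.card_insert_of_notMem hj] at h2
    rw [Finset.card_insert_of_notMem hij', Finset.card_insert_of_notMem hj] at h3
    rw [← Nat.cast_add, ← Nat.cast_add, Nat.cast_le]
    simp only [sparsePavingRank, Finset.card_insert_of_notMem hi, Finset.card_insert_of_notMem hj,
      Finset.card_insert_of_notMem hij']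
    by_cases hP : insert i (insert j X) ∈ C <;> by_cases hQ : insert i X ∈ C <;>
      by_cases hR : insert j X ∈ C <;> by_cases hS : X ∈ C <;>
      simp only [hP, hQ, hR, hS, if_true, if_false, forall_const, false_imp_iff]
        at h0 h1 h2 h3 h4 ⊢ <;>
      omega

/-- Replacing `p` by a free element of rank one and `q` by an element in general position on the
line through `e` and `p`. -/
def lineExtension {U : Type*} [DecidableEq U] (f : Finset U → ℕ) (e p q : U) (X : Finset U) : ℕ :=
  f (if p ∈ X ∧ q ∈ X then insert e (X \ {p, q}) else X \ {p, q}) +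
    if p ∈ X ∨ q ∈ X then 1 else 0

theorem sEntLike_lineExtension {U : Type*} [DecidableEq U] {f : Finset U → ℕ}
    (hf : SEntLike fun X => (f X : ℝ)) {e : U} (he : f {e} ≤ 1) (p q : U) :
    SEntLike fun X => (lineExtension f e p q X : ℝ) := by
  have h0 : f ∅ = 0 := Nat.cast_eq_zero.1 hf.1
  have mono : ∀ {X Y}, X ⊆ Y → f X ≤ f Y := fun h => Nat.cast_le.1 (hf.2.1 _ _ h)
  have sub : ∀ X Y, f (X ∩ Y) + f (X ∪ Y) ≤ f X + f Y := fun X Y => by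
    have h : (f (X ∩ Y) : ℝ) + f (X ∪ Y) ≤ f X + f Y := hf.2.2 X Y
    exact_mod_cast h
  refine ⟨by simp [lineExtension, h0], fun X Y hXY => ?_, fun X Y => ?_⟩
  · have hp := @hXY p
    have hq := @hXY q
    have hAB := Finset.sdiff_subset_sdiff hXY (le_refl {p, q})
    have h1 := mono hAB
    have h2 := mono (Finset.insert_subset_insert e hAB)
    have h3 := mono (Finset.subset_insert e (Y \ {p, q}))
    rw [Nat.cast_le, lineExtension, lineExtension]
    split_ifs <;> first | omega | tauto
  · rw [← Nat.cast_add, ← Nat.cast_add, Nat.cast_le]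
    have inter_sdiff : (X ∩ Y) \ {p, q} = X \ {p, q} ∩ (Y \ {p, q}) := inf_sdiff
    simp only [lineExtension, inter_sdiff, Finset.union_sdiff_distrib,
      Finset.mem_inter, Finset.mem_union]
    clear inter_sdiff
    generalize X \ {p, q} = A
    generalize Y \ {p, q} = B
    have h1 := sub A B
    have h2 := sub (insert e A) (insert e B)
    rw [← Finset.insert_inter_distrib, ← Finset.insert_union_distrib] at h2
    have h3 := sub (insert e A) B
    rw [Finset.insert_union] at h3
    have h4 := sub A (insert e B)
    rw [Finset.union_insert] at h4
    have h5 := sub {e} (A ∪ B)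
    rw [← Finset.insert_eq] at h5
    have h6 := mono (Finset.inter_subset_inter_right (u := B) (Finset.subset_insert e A))
    have h7 := mono (Finset.inter_subset_inter_left (s := A) (Finset.subset_insert e B))
    by_cases p ∈ X <;> by_cases q ∈ X <;> by_cases p ∈ Y <;> by_cases q ∈ Y <;>
      simp [*] <;> omega

/-- The rank function of the Vámos matroid, extended by the elements `8` and `9`. -/
def vamosExtRank : Finset (Fin 10) → ℕ :=
  lineExtension (sparsePavingRank 4
    {{0, 1, 4, 5}, {0, 1, 6, 7}, {2, 3, 4, 5}, {2, 3, 6, 7}, {4, 5, 6, 7}}) 6 8 9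

theorem sEntLike_vamosExtRank : SEntLike fun X => (vamosExtRank X : ℝ) :=
  sEntLike_lineExtension (sEntLike_sparsePavingRank (by decide +kernel) (by decide +kernel))
    (by decide +kernel) 8 9

theorem five_le_SEnt_vamosGraph : 5 ≤ SEnt vamosGraph := by
  refine le_csSup ⟨10, ?_⟩ ⟨_, sEntLike_vamosExtRank, ?_, ?_, ?_⟩
  · rintro _ ⟨f, hf, h1, -, rfl⟩
    simpa using hf.le_card h1 univ
  · have h : ∀ j, vamosExtRank {j} ≤ 1 := by decide
    exact fun j => by exact_mod_cast h j
  · have h : ∀ j, vamosExtRank (insert j (vamosNbr j)) = vamosExtRank (vamosNbr j) := by decide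
    intro j
    rw [inNbr_vamosGraph]
    exact congrArg Nat.cast (h j)
  · have h : vamosExtRank univ = 5 := by decide
    exact (congrArg Nat.cast h).symm

end VamosGraph

/-- There exists a finite directed graph `G` with
`E_ZY(G) < E_S(G)`; since `E(G) ≤ E_ZY(G)`, the Zhang–Yeung non-Shannon inequality
yields a strictly better upper bound on the general entropy of `G` than Shannon's
classical information inequalities. -/
theorem exists_graph_ZYEnt_lt_SEnt :
    ∃ (n : ℕ) (E : Fin n → Fin n → Prop) (inst : DecidableRel E),
      @ZYEnt (Fin n) _ _ E inst < @SEnt (Fin n) _ _ E inst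
      ∧ @genEntropy (Fin n) _ _ E inst ≤ @ZYEnt (Fin n) _ _ E inst := by
  have hbound : ∀ h ∈ {h : ℝ | ∃ f : Finset (Fin 10) → ℝ, ZYEntLike f ∧ (∀ j, f {j} ≤ 1) ∧
      FConstraints vamosGraph f ∧ h = f Finset.univ}, h ≤ 74 / 15 := by
    rintro _ ⟨f, hf, h1, hE, rfl⟩
    exact hf.univ_le_of_vamosGraph h1 hE
  refine ⟨10, vamosGraph, inferInstance, lt_of_le_of_lt (Real.sSup_le hbound (by norm_num)) ?_,
    genEntropy_le_ZYEnt vamosGraph ⟨_, hbound⟩⟩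
  exact lt_of_lt_of_le (by norm_num) five_le_SEnt_vamosGraph
end
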